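/- arXiv:math/0509441 — 3 statements merged into one kernel-verified Lean document; each statement's English description precedes it below -/
import Mathlib

section
/- Let n ≥ 2, let A be a fixed n × n real matrix with tr(AAᵀ) = n, let M be a random matrix in the orthogonal group O(n) distributed according to Haar probability measure, let W = tr(AM), and let Z be a standard normal random variable. Then d_TV(W, Z) ≤ 2√(2 + 6/((n−1)(n+2))) / (n − 1). -/
open MeasureTheory ProbabilityTheory Matrix

noncomputable instance {n : ℕ} : MeasurableSpace (Matrix.orthogonalGroup (Fin n) ℝ) :=
  borel _

instance {n : ℕ} : BorelSpace (Matrix.orthogonalGroup (Fin n) ℝ) := ⟨rfl⟩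

section basics
variable {n : ℕ}

lemma og_mul_transpose (M : Matrix.orthogonalGroup (Fin n) ℝ) : (M : Matrix (Fin n) (Fin n) ℝ) * (M : Matrix (Fin n) (Fin n) ℝ)ᵀ = 1 :=
  (Matrix.mem_orthogonalGroup_iff (Fin n) ℝ).1 M.2

lemma og_transpose_mul (M : Matrix.orthogonalGroup (Fin n) ℝ) : (M : Matrix (Fin n) (Fin n) ℝ)ᵀ * (M : Matrix (Fin n) (Fin n) ℝ) = 1 :=
  (Matrix.mem_orthogonalGroup_iff' (Fin n) ℝ).1 M.2

lemma og_row_sum (M : Matrix.orthogonalGroup (Fin n) ℝ) (i : Fin n) : ∑ j, (M : Matrix (Fin n) (Fin n) ℝ) i j ^ 2 = 1 := by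
  have := congrFun (congrFun (og_mul_transpose M) i) i
  simpa [Matrix.mul_apply, sq] using this

lemma og_col_sum (M : Matrix.orthogonalGroup (Fin n) ℝ) (j : Fin n) : ∑ i, (M : Matrix (Fin n) (Fin n) ℝ) i j ^ 2 = 1 := by
  have := congrFun (congrFun (og_transpose_mul M) j) j
  simpa [Matrix.mul_apply, sq] using this

lemma og_entry_le (M : Matrix.orthogonalGroup (Fin n) ℝ) (i j : Fin n) : |(M : Matrix (Fin n) (Fin n) ℝ) i j| ≤ 1 := by
  have h := og_row_sum M i
  have h2 : (M : Matrix (Fin n) (Fin n) ℝ) i j ^ 2 ≤ 1 := by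
    rw [← h]
    exact Finset.single_le_sum (f := fun j => (M : Matrix (Fin n) (Fin n) ℝ) i j ^ 2)
      (fun _ _ => sq_nonneg _) (Finset.mem_univ j)
  exact (sq_le_one_iff_abs_le_one _).1 h2

instance og_topgroup : IsTopologicalGroup (Matrix.orthogonalGroup (Fin n) ℝ) :=
  inferInstanceAs (IsTopologicalGroup (unitary (Matrix (Fin n) (Fin n) ℝ)))

instance og_compact : CompactSpace (Matrix.orthogonalGroup (Fin n) ℝ) := by
  suffices hh : IsCompact ((Matrix.orthogonalGroup (Fin n) ℝ : Submonoid _) : Set (Matrix (Fin n) (Fin n) ℝ)) from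
    isCompact_iff_compactSpace.1 hh
  have hK : IsCompact (Set.univ.pi fun _ : Fin n => Set.univ.pi fun _ : Fin n => Set.Icc (-1 : ℝ) 1) :=
    isCompact_univ_pi fun _ => isCompact_univ_pi fun _ => isCompact_Icc
  refine hK.of_isClosed_subset ?_ ?_
  · have : ((Matrix.orthogonalGroup (Fin n) ℝ : Submonoid _) : Set (Matrix (Fin n) (Fin n) ℝ)) =
        {M | M * Mᵀ = 1} := by
      ext M
      exact Matrix.mem_orthogonalGroup_iff (Fin n) ℝ
    rw [this]
    exact isClosed_eq (by fun_prop) continuous_const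
  · intro M hM i _ j _
    exact abs_le.1 (og_entry_le ⟨M, hM⟩ i j)

lemma og_cont : Continuous (fun M : Matrix.orthogonalGroup (Fin n) ℝ => (M : Matrix (Fin n) (Fin n) ℝ)) :=
  continuous_subtype_val

lemma og_cont_entry (i j : Fin n) :
    Continuous (fun M : Matrix.orthogonalGroup (Fin n) ℝ => (M : Matrix (Fin n) (Fin n) ℝ) i j) :=
  og_cont.matrix_elem i j

lemma og_integrable (μ : Measure (Matrix.orthogonalGroup (Fin n) ℝ)) [IsFiniteMeasure μ]
    {f : Matrix.orthogonalGroup (Fin n) ℝ → ℝ} (hf : Continuous f) : Integrable f μ :=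
  hf.integrable_of_hasCompactSupport (HasCompactSupport.of_compactSpace f)

lemma og_map_right (μ : Measure (Matrix.orthogonalGroup (Fin n) ℝ)) [μ.IsHaarMeasure]
    [IsProbabilityMeasure μ] (g : Matrix.orthogonalGroup (Fin n) ℝ) : μ.map (· * g) = μ := by
  have : IsProbabilityMeasure (μ.map (· * g)) :=
    Measure.isProbabilityMeasure_map (measurable_mul_const g).aemeasurable
  have : (μ.map (· * g)).IsHaarMeasure := inferInstance
  exact Measure.isHaarMeasure_eq_of_isProbabilityMeasure _ _

lemma og_left (μ : Measure (Matrix.orthogonalGroup (Fin n) ℝ)) [μ.IsHaarMeasure]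
    (f : Matrix.orthogonalGroup (Fin n) ℝ → ℝ) (g : Matrix.orthogonalGroup (Fin n) ℝ) :
    ∫ M, f (g * M) ∂μ = ∫ M, f M ∂μ := integral_mul_left_eq_self f g

lemma og_right (μ : Measure (Matrix.orthogonalGroup (Fin n) ℝ)) [μ.IsHaarMeasure]
    [IsProbabilityMeasure μ]
    (f : Matrix.orthogonalGroup (Fin n) ℝ → ℝ) (g : Matrix.orthogonalGroup (Fin n) ℝ) :
    ∫ M, f (M * g) ∂μ = ∫ M, f M ∂μ := by
  have : μ.IsMulRightInvariant := ⟨og_map_right μ⟩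
  exact integral_mul_right_eq_self f g

/-- Rotation in the plane of coordinates `i`, `k`. -/
noncomputable def rotMat (i k : Fin n) (t : ℝ) : Matrix (Fin n) (Fin n) ℝ :=
  1 + (Real.cos t - 1) • (Matrix.single i i 1 + Matrix.single k k 1)
    + Real.sin t • (Matrix.single i k 1 - Matrix.single k i 1)

lemma rotMat_mem {i k : Fin n} (h : i ≠ k) (t : ℝ) :
    rotMat i k t ∈ Matrix.orthogonalGroup (Fin n) ℝ := by
  rw [Matrix.mem_orthogonalGroup_iff]
  change rotMat i k t * (rotMat i k t)ᵀ = 1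
  set P : Matrix (Fin n) (Fin n) ℝ := Matrix.single i i 1 + Matrix.single k k 1 with hP
  set J : Matrix (Fin n) (Fin n) ℝ := Matrix.single i k 1 - Matrix.single k i 1 with hJ
  have hPP : P * P = P := by
    simp [hP, add_mul, mul_add, h, h.symm]
  have hPJ : P * J = J := by
    simp [hP, hJ, add_mul, mul_sub, h, h.symm]
  have hJP : J * P = J := by
    simp [hP, hJ, sub_mul, mul_add, h, h.symm]
    try abel
  have hJJ : J * J = - P := by
    simp [hP, hJ, sub_mul, mul_sub, h, h.symm]
    try abel
  have hT : (rotMat i k t)ᵀ = 1 + (Real.cos t - 1) • P - Real.sin t • J := by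
    simp [rotMat, hP, hJ, smul_sub]
    try abel
  rw [hT]
  change (1 + (Real.cos t - 1) • P + Real.sin t • J) * _ = 1
  have e : (1 + (Real.cos t - 1) • P + Real.sin t • J) * (1 + (Real.cos t - 1) • P - Real.sin t • J)
     = 1 + (2 * (Real.cos t - 1) + (Real.cos t - 1)^2 + Real.sin t ^2) • P := by
    simp only [add_mul, mul_sub, mul_add, one_mul, mul_one, smul_mul_assoc, mul_smul_comm, hPP, hPJ, hJP, hJJ]
    module
  rw [e]
  have : 2 * (Real.cos t - 1) + (Real.cos t - 1)^2 + Real.sin t ^2 = 0 := by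
    nlinarith [Real.sin_sq_add_cos_sq t]
  simp [this]

/-- The rotation as an element of the orthogonal group. -/
noncomputable def rot {i k : Fin n} (h : i ≠ k) (t : ℝ) : Matrix.orthogonalGroup (Fin n) ℝ :=
  ⟨rotMat i k t, rotMat_mem h t⟩

lemma rotMat_mul_apply (i k : Fin n) (t : ℝ) (S : Matrix (Fin n) (Fin n) ℝ) (a b : Fin n) :
    (rotMat i k t * S) a b = S a b + (Real.cos t - 1) * ((if a = i then S i b else 0)
      + (if a = k then S k b else 0)) + Real.sin t * ((if a = i then S k b else 0)
      - (if a = k then S i b else 0)) := by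
  have key : ∀ p q : Fin n, (Matrix.single p q (1:ℝ) * S) a b = if a = p then S q b else 0 := by
    intro p q
    split_ifs with h
    · subst h; simp
    · simp [Matrix.single_mul_apply_of_ne _ _ _ _ _ h]
  simp only [rotMat, add_mul, sub_mul, Matrix.add_apply, Matrix.sub_apply, Matrix.smul_apply,
    Matrix.smul_mul, key, one_mul, smul_eq_mul]

lemma mul_rotMat_apply (i k : Fin n) (t : ℝ) (S : Matrix (Fin n) (Fin n) ℝ) (a b : Fin n) :
    (S * rotMat i k t) a b = S a b + (Real.cos t - 1) * ((if b = i then S a i else 0)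
      + (if b = k then S a k else 0)) + Real.sin t * ((if b = k then S a i else 0)
      - (if b = i then S a k else 0)) := by
  have key : ∀ p q : Fin n, (S * Matrix.single p q (1:ℝ)) a b = if b = q then S a p else 0 := by
    intro p q
    split_ifs with h
    · subst h; simp
    · simp [Matrix.mul_single_apply_of_ne _ _ _ _ _ h]
  simp only [rotMat, mul_add, mul_sub, Matrix.add_apply, Matrix.sub_apply, Matrix.smul_apply,
    Matrix.mul_smul, key, mul_one, smul_eq_mul]

/-- Sign flip of coordinate `x`. -/
noncomputable def flipO (x : Fin n) : Matrix.orthogonalGroup (Fin n) ℝ :=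
  ⟨Matrix.diagonal fun i => if i = x then -1 else 1, by
    rw [Matrix.mem_orthogonalGroup_iff]
    rw [Matrix.diagonal_transpose, Matrix.diagonal_mul_diagonal, ← Matrix.diagonal_one]
    congr 1
    ext i
    split_ifs <;> simp⟩

/-- Matrix entries as functions on the group. -/
noncomputable def ent (M : Matrix.orthogonalGroup (Fin n) ℝ) (i j : Fin n) : ℝ :=
  (M : Matrix (Fin n) (Fin n) ℝ) i j

@[fun_prop]
lemma ent_continuous (i j : Fin n) : Continuous (fun M => ent (n := n) M i j) := og_cont_entry i j

lemma ent_col_sum (M : Matrix.orthogonalGroup (Fin n) ℝ) (j : Fin n) : ∑ i, ent M i j ^ 2 = 1 :=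
  og_col_sum M j

lemma flipO_mul_apply (x : Fin n) (M : Matrix.orthogonalGroup (Fin n) ℝ) (a b : Fin n) :
    ent (flipO x * M) a b = (if a = x then -1 else 1) * ent M a b := by
  have h := Matrix.diagonal_mul (fun i => if i = x then (-1 : ℝ) else 1) (M : Matrix (Fin n) (Fin n) ℝ) a b
  exact h

end basics

section moments
variable {n : ℕ}

lemma quartic_of_rot (μ : Measure (Matrix.orthogonalGroup (Fin n) ℝ)) [IsProbabilityMeasure μ]
    {x y : Matrix.orthogonalGroup (Fin n) ℝ → ℝ} (hx : Continuous x) (hy : Continuous y)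
    (h : ∀ t : ℝ, ∫ M, (Real.cos t * x M + Real.sin t * y M) ^ 4 ∂μ = ∫ M, x M ^ 4 ∂μ) :
    ∫ M, x M ^ 4 ∂μ = 3 * ∫ M, x M ^ 2 * y M ^ 2 ∂μ := by
  have h2 := h (Real.pi / 2)
  have h4 := h (Real.pi / 4)
  have h4' := h (-(Real.pi / 4))
  simp only [Real.cos_pi_div_two, Real.sin_pi_div_two, zero_mul, zero_add, one_mul] at h2
  rw [Real.cos_pi_div_four, Real.sin_pi_div_four] at h4
  rw [Real.cos_neg, Real.sin_neg, Real.cos_pi_div_four, Real.sin_pi_div_four] at h4'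
  have hs : (√2 / 2) ^ 4 = (1 / 4 : ℝ) := by
    have : (√2) ^ 2 = (2:ℝ) := Real.sq_sqrt (by norm_num)
    calc (√2 / 2) ^ 4 = ((√2) ^ 2) ^ 2 / 16 := by ring
      _ = _ := by rw [this]; norm_num
  have e1 : ∀ M, (√2 / 2 * x M + √2 / 2 * y M) ^ 4 = 1 / 4 * (x M + y M) ^ 4 := by
    intro M; rw [← hs]; ring
  have e2 : ∀ M, (√2 / 2 * x M + -(√2 / 2) * y M) ^ 4 = 1 / 4 * (x M - y M) ^ 4 := by
    intro M; rw [← hs]; ring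
  simp_rw [e1] at h4
  simp_rw [e2] at h4'
  have i1 : Integrable (fun M => 1 / 4 * (x M + y M) ^ 4) μ := og_integrable μ (by fun_prop)
  have i2 : Integrable (fun M => 1 / 4 * (x M - y M) ^ 4) μ := og_integrable μ (by fun_prop)
  have i3 : Integrable (fun M => 1 / 2 * x M ^ 4) μ := og_integrable μ (by fun_prop)
  have i4 : Integrable (fun M => 1 / 2 * y M ^ 4) μ := og_integrable μ (by fun_prop)
  have i5 : Integrable (fun M => 3 * (x M ^ 2 * y M ^ 2)) μ := og_integrable μ (by fun_prop)
  have i34 : Integrable (fun M => 1 / 2 * x M ^ 4 + 1 / 2 * y M ^ 4) μ := i3.add i4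
  have hadd := integral_add i1 i2
  have e3 : ∀ M, 1 / 4 * (x M + y M) ^ 4 + 1 / 4 * (x M - y M) ^ 4
      = (1 / 2 * x M ^ 4 + 1 / 2 * y M ^ 4) + 3 * (x M ^ 2 * y M ^ 2) := by intro M; ring
  simp_rw [e3] at hadd
  rw [integral_add i34 i5, integral_add i3 i4, h4, h4', integral_const_mul, integral_const_mul,
    integral_const_mul, h2] at hadd
  linarith

variable (μ : Measure (Matrix.orthogonalGroup (Fin n) ℝ)) [μ.IsHaarMeasure] [IsProbabilityMeasure μ]

lemma rot_left_apply {i k : Fin n} (h : i ≠ k) (t : ℝ) (M : Matrix.orthogonalGroup (Fin n) ℝ) (j : Fin n) :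
    ent (rot h t * M) i j
      = Real.cos t * ent M i j + Real.sin t * ent M k j := by
  change (rotMat i k t * (M : Matrix (Fin n) (Fin n) ℝ)) i j = _
  rw [rotMat_mul_apply]
  simp [h, ent]
  ring

lemma rot_left_apply_ne {i k : Fin n} (h : i ≠ k) (t : ℝ) (M : Matrix.orthogonalGroup (Fin n) ℝ) (a j : Fin n)
    (hi : a ≠ i) (hk : a ≠ k) :
    ent (rot h t * M) a j
      = ent M a j := by
  change (rotMat i k t * (M : Matrix (Fin n) (Fin n) ℝ)) a j = _
  rw [rotMat_mul_apply]
  simp [hi, hk, ent]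

lemma rot_right_apply {j l : Fin n} (h : l ≠ j) (t : ℝ) (M : Matrix.orthogonalGroup (Fin n) ℝ) (i : Fin n) :
    ent (M * rot h t) i j
      = Real.cos t * ent M i j + Real.sin t * ent M i l := by
  change ((M : Matrix (Fin n) (Fin n) ℝ) * rotMat l j t) i j = _
  rw [mul_rotMat_apply]
  simp [h.symm, ent]
  ring

lemma mom_swap (p : ℕ) (i k j : Fin n) :
    ∫ M, ent M k j ^ p ∂μ = ∫ M, ent M i j ^ p ∂μ := by
  by_cases h : i = k
  · rw [h]
  · rw [← og_left μ (fun M => ent M i j ^ p) (rot h (Real.pi / 2))]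
    simp [rot_left_apply]

lemma mom2 (i j : Fin n) : ∫ M, ent M i j ^ 2 ∂μ = 1 / n := by
  have hn : (n : ℝ) ≠ 0 := by
    have := i.pos
    positivity
  have hc := fun i j => ent_continuous (n := n) i j
  have h1 : ∫ M, ∑ k, ent M k j ^ 2 ∂μ = 1 := by
    simp [ent_col_sum]
  rw [integral_finsetSum _ (fun k _ => og_integrable μ (by fun_prop))] at h1
  simp_rw [fun k => mom_swap μ 2 i k j] at h1
  simp at h1
  field_simp
  linarith

lemma mom22_col {i k : Fin n} (h : i ≠ k) (j : Fin n) :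
    ∫ M, ent M i j ^ 4 ∂μ =
      3 * ∫ M, ent M i j ^ 2 * ent M k j ^ 2 ∂μ := by
  refine quartic_of_rot μ (ent_continuous i j) (ent_continuous k j) fun t => ?_
  rw [← og_left μ (fun M => ent M i j ^ 4) (rot h t)]
  simp [rot_left_apply]

lemma mom22_row {j l : Fin n} (h : l ≠ j) (i : Fin n) :
    ∫ M, ent M i j ^ 4 ∂μ =
      3 * ∫ M, ent M i j ^ 2 * ent M i l ^ 2 ∂μ := by
  refine quartic_of_rot μ (ent_continuous i j) (ent_continuous i l) fun t => ?_
  rw [← og_right μ (fun M => ent M i j ^ 4) (rot h t)]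
  simp [rot_right_apply]

lemma mom4 (i j : Fin n) : ∫ M, ent M i j ^ 4 ∂μ = 3 / (n * (n + 2)) := by
  have hn : (0 : ℝ) < n := by exact_mod_cast i.pos
  have hc := fun i j => ent_continuous (n := n) i j
  have h1 : ∫ M, ∑ k, ent M i j ^ 2 * ent M k j ^ 2 ∂μ
      = 1 / n := by
    simp_rw [← Finset.mul_sum, ent_col_sum, mul_one]
    exact mom2 μ i j
  rw [integral_finsetSum _ (fun k _ => og_integrable μ (by fun_prop))] at h1
  rw [← Finset.add_sum_erase _ _ (Finset.mem_univ i)] at h1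
  have h2 : ∀ k ∈ Finset.univ.erase i,
      ∫ M, ent M i j ^ 2 * ent M k j ^ 2 ∂μ
      = (∫ M, ent M i j ^ 4 ∂μ) / 3 := by
    intro k hk
    rw [mom22_col μ (Finset.ne_of_mem_erase hk).symm j]
    ring
  rw [Finset.sum_congr rfl h2] at h1
  simp_rw [← pow_add] at h1
  rw [Finset.sum_const, Finset.card_erase_of_mem (Finset.mem_univ i), Finset.card_univ, Fintype.card_fin,
    nsmul_eq_mul, Nat.cast_sub (by have := i.pos; omega)] at h1
  norm_num at h1
  field_simp at h1 ⊢
  linarith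

lemma mom22_swap {i k k' : Fin n} (h : k ≠ i) (h' : k' ≠ i) (j l : Fin n) :
    ∫ M, ent M i j ^ 2 * ent M k' l ^ 2 ∂μ
     = ∫ M, ent M i j ^ 2 * ent M k l ^ 2 ∂μ := by
  by_cases hk : k = k'
  · rw [hk]
  · rw [← og_left μ (fun M => ent M i j ^ 2
      * ent M k l ^ 2) (rot hk (Real.pi / 2))]
    simp [rot_left_apply, rot_left_apply_ne hk _ _ i j h.symm h'.symm]

lemma mom22 {i k j l : Fin n} (h : k ≠ i) (hl : l ≠ j) :
    ∫ M, ent M i j ^ 2 * ent M k l ^ 2 ∂μ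
     = (n + 1) / ((n - 1) * n * (n + 2)) := by
  have hn0 : 1 < n := by
    rcases n with _ | _ | n
    · exact i.elim0
    · exact absurd (by omega) h
    · omega
  have hn : (1 : ℝ) < n := by exact_mod_cast hn0
  have hn1 : (0 : ℝ) < n - 1 := by linarith
  have hc := fun i j => ent_continuous (n := n) i j
  have h1 : ∫ M, ∑ k, ent M i j ^ 2 * ent M k l ^ 2 ∂μ
      = 1 / n := by
    simp_rw [← Finset.mul_sum, ent_col_sum, mul_one]
    exact mom2 μ i j
  rw [integral_finsetSum _ (fun k _ => og_integrable μ (by fun_prop))] at h1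
  rw [← Finset.add_sum_erase _ _ (Finset.mem_univ i)] at h1
  have h2 : ∀ k' ∈ Finset.univ.erase i,
      ∫ M, ent M i j ^ 2 * ent M k' l ^ 2 ∂μ
      = ∫ M, ent M i j ^ 2 * ent M k l ^ 2 ∂μ := by
    intro k' hk
    exact mom22_swap μ h (Finset.ne_of_mem_erase hk) j l
  rw [Finset.sum_congr rfl h2] at h1
  have h3 := mom22_row μ hl i
  rw [mom4] at h3
  rw [Finset.sum_const, Finset.card_erase_of_mem (Finset.mem_univ i), Finset.card_univ, Fintype.card_fin,
    nsmul_eq_mul, Nat.cast_sub (by omega), Nat.cast_one] at h1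
  set X := ∫ M, ent M i j ^ 2 * ent M i l ^ 2 ∂μ
  set Y := ∫ M, ent M i j ^ 2 * ent M k l ^ 2 ∂μ
  have hX : X = 1 / (n * (n + 2)) := by
    field_simp at h3 ⊢
    linarith
  have hY : Y = (1 / n - X) / (n - 1) := by
    field_simp
    field_simp at h1
    linarith
  rw [hY, hX]
  field_simp
  ring

/-- second order sign vanishing -/
lemma mom_pair (i j : Fin n) :
    ∫ M, ent M i j * ent M j i ∂μ
      = if i = j then 1 / (n : ℝ) else 0 := by
  split_ifs with h
  · subst h
    simp_rw [← sq]
    exact mom2 μ i i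
  · have := og_left μ (fun M => ent M i j * ent M j i) (flipO i)
    simp only [flipO_mul_apply, if_true, if_neg (Ne.symm h), one_mul, neg_mul] at this
    rw [integral_neg] at this
    linarith

lemma mom_quad_zero (x i j k l : Fin n)
    (h : (if i = x then (-1 : ℝ) else 1) * (if j = x then (-1 : ℝ) else 1) *
      (if k = x then (-1 : ℝ) else 1) * (if l = x then (-1 : ℝ) else 1) = -1) :
    ∫ M, ent M i j * ent M j i *
      ent M k l * ent M l k ∂μ = 0 := by
  have := og_left μ (fun M => ent M i j * ent M j i *
      ent M k l * ent M l k) (flipO x)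
  simp only [flipO_mul_apply] at this
  have e : ∀ M : Matrix.orthogonalGroup (Fin n) ℝ,
    (if i = x then (-1 : ℝ) else 1) * ent M i j *
     ((if j = x then (-1 : ℝ) else 1) * ent M j i) *
      ((if k = x then (-1 : ℝ) else 1) * ent M k l) *
      ((if l = x then (-1 : ℝ) else 1) * ent M l k)
     = - (ent M i j * ent M j i *
      ent M k l * ent M l k) := by
    intro M
    linear_combination (ent M i j * ent M j i * ent M k l * ent M l k) * h
  simp_rw [e] at this
  rw [integral_neg] at this
  linarith

lemma mom_quad (i j k l : Fin n) :
    ∫ M, ent M i j * ent M j i *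
      ent M k l * ent M l k ∂μ
    = ((n + 1) / ((n - 1) * n * (n + 2)) : ℝ) * ((if j = i then if l = k then 1 else 0 else 0)
        + (if k = i then if l = j then 1 else 0 else 0) + (if l = i then if k = j then 1 else 0 else 0))
      + (3 / (n * (n + 2)) - 3 * ((n + 1) / ((n - 1) * n * (n + 2))) : ℝ) *
        (if j = i then if k = i then if l = i then 1 else 0 else 0 else 0) := by
  by_cases hij : j = i
  · subst hij
    by_cases hkl : l = k
    · subst hkl
      by_cases hjl : l = j
      · subst hjl
        have := mom4 μ l l
        simp only [if_true]
        rw [show (fun M : Matrix.orthogonalGroup (Fin n) ℝ => ent M l l * ent M l l *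
          ent M l l * ent M l l) = fun M => ent M l l ^ 4 by
            ext M; ring, this]
        ring
      · simp only [if_true, if_neg hjl]
        rw [show (fun M : Matrix.orthogonalGroup (Fin n) ℝ => ent M j j * ent M j j *
          ent M l l * ent M l l) = fun M => ent M j j ^ 2 * ent M l l ^ 2 by
            ext M; ring, mom22 μ hjl hjl]
        ring
    · have : k ≠ j ∨ l ≠ j := by
        by_contra hh
        push Not at hh
        exact hkl (hh.2.trans hh.1.symm)
      rw [mom_quad_zero μ k j j k l (by simp [hkl]; split_ifs <;> norm_num)]
      grind
  · by_cases h1 : k = i ∧ l = j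
    · obtain ⟨rfl, rfl⟩ := h1
      rw [show (fun M : Matrix.orthogonalGroup (Fin n) ℝ => ent M k l * ent M l k *
          ent M k l * ent M l k) = fun M => ent M k l ^ 2 * ent M l k ^ 2 by
            ext M; ring, mom22 μ hij (Ne.symm hij)]
      simp [hij]
    · by_cases h2 : l = i ∧ k = j
      · obtain ⟨rfl, rfl⟩ := h2
        rw [show (fun M : Matrix.orthogonalGroup (Fin n) ℝ => ent M l k * ent M k l *
          ent M k l * ent M l k) = fun M => ent M l k ^ 2 * ent M k l ^ 2 by
            ext M; ring, mom22 μ hij (Ne.symm hij)]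
        simp [hij]
      · have : ∃ x, (if i = x then (-1 : ℝ) else 1) * (if j = x then (-1 : ℝ) else 1) *
            (if k = x then (-1 : ℝ) else 1) * (if l = x then (-1 : ℝ) else 1) = -1 := by
          by_cases a1 : k = i
          · have : l ≠ j := fun h => h1 ⟨a1, h⟩
            refine ⟨j, ?_⟩
            subst a1
            simp [this, Ne.symm hij]
          · by_cases a2 : l = i
            · have : k ≠ j := fun h => h2 ⟨a2, h⟩
              refine ⟨j, ?_⟩
              subst a2
              simp [this, Ne.symm hij]
            · exact ⟨i, by simp [hij, a1, a2]⟩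
        obtain ⟨x, hx⟩ := this
        rw [mom_quad_zero μ x i j k l hx]
        grind

lemma mom_tr_diag (d : Fin n → ℝ) (hd : ∑ i, d i ^ 2 = n) (hn : 2 ≤ n) :
    ∫ M : Matrix.orthogonalGroup (Fin n) ℝ, ∑ i, ∑ j, d i * d j * (ent M i j
      * ent M j i) ∂μ = 1 := by
  have hc := fun i j => ent_continuous (n := n) i j
  rw [integral_finsetSum _ (fun i _ => og_integrable μ (by fun_prop))]
  simp_rw [fun i => integral_finsetSum (μ := μ) Finset.univ (f := fun j (M : Matrix.orthogonalGroup (Fin n) ℝ) =>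
    d i * d j * (ent M i j * ent M j i))
      (fun j _ => og_integrable μ (by fun_prop)), integral_const_mul, mom_pair]
  simp [← sq]
  rw [← Finset.sum_mul, hd, mul_inv_cancel₀]
  positivity

lemma mom_tr_sq_diag (d : Fin n → ℝ) (hd : ∑ i, d i ^ 2 = n) (hn : 2 ≤ n) :
    ∫ M : Matrix.orthogonalGroup (Fin n) ℝ, (∑ i, ∑ j, d i * d j * (ent M i j
      * ent M j i)) ^ 2 ∂μ ≤ 3 + 6 / (((n : ℝ) - 1) * (n + 2)) := by
  have hc := fun i j => ent_continuous (n := n) i j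
  have hn' : (2 : ℝ) ≤ n := by exact_mod_cast hn
  have hn1 : (0 : ℝ) < n - 1 := by linarith
  have e : ∀ M : Matrix.orthogonalGroup (Fin n) ℝ, (∑ i, ∑ j, d i * d j * (ent M i j
      * ent M j i)) ^ 2 = ∑ i, ∑ j, ∑ k, ∑ l, (d i * d j * d k * d l) *
       (ent M i j * ent M j i *
      ent M k l * ent M l k) := by
    intro M
    rw [sq]
    simp_rw [Finset.sum_mul, Finset.mul_sum]
    refine Finset.sum_congr rfl fun i _ => Finset.sum_congr rfl fun j _ =>
      Finset.sum_congr rfl fun k _ => Finset.sum_congr rfl fun l _ => by ring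
  simp_rw [e]
  have e2 : ∫ M : Matrix.orthogonalGroup (Fin n) ℝ, (∑ i, ∑ j, ∑ k, ∑ l, (d i * d j * d k * d l) *
       (ent M i j * ent M j i *
      ent M k l * ent M l k)) ∂μ
      = ∑ i, ∑ j, ∑ k, ∑ l, (d i * d j * d k * d l) * 
      ∫ M : Matrix.orthogonalGroup (Fin n) ℝ, ent M i j * ent M j i *
      ent M k l * ent M l k ∂μ := by
    rw [integral_finsetSum _ (fun i _ => og_integrable μ (by fun_prop))]
    refine Finset.sum_congr rfl fun i _ => ?_
    rw [integral_finsetSum _ (fun i _ => og_integrable μ (by fun_prop))]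
    refine Finset.sum_congr rfl fun j _ => ?_
    rw [integral_finsetSum _ (fun i _ => og_integrable μ (by fun_prop))]
    refine Finset.sum_congr rfl fun k _ => ?_
    rw [integral_finsetSum _ (fun i _ => og_integrable μ (by fun_prop))]
    refine Finset.sum_congr rfl fun l _ => ?_
    rw [integral_const_mul]
  rw [e2]
  simp_rw [mom_quad]
  set c : ℝ := ((n + 1) / ((n - 1) * n * (n + 2)) : ℝ) with hcdef
  have e3 : ∑ i, ∑ j, ∑ k, ∑ l, (d i * d j * d k * d l) * (c * ((if j = i then if l = k then 1 else 0 else 0)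
        + (if k = i then if l = j then 1 else 0 else 0) + (if l = i then if k = j then 1 else 0 else 0))
      + (3 / (n * (n + 2)) - 3 * c : ℝ) *
        (if j = i then if k = i then if l = i then 1 else 0 else 0 else 0))
      = 3 * c * (∑ i, d i ^ 2) ^ 2 + (3 / (n * (n + 2)) - 3 * c : ℝ) * ∑ i, d i ^ 4 := by
    have t1 : ∑ i, ∑ j, ∑ k, ∑ l, (d i * d j * d k * d l) * (if j = i then if l = k then 1 else 0 else 0)
        = (∑ i, d i ^ 2) ^ 2 := by
      rw [sq, Finset.sum_mul_sum]
      refine Finset.sum_congr rfl fun i _ => ?_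
      simp only [mul_ite, mul_one, mul_zero]
      rw [Finset.sum_eq_single i (by intro b _ hb; simp [hb]) (by simp)]
      simp
      exact Finset.sum_congr rfl fun k _ => by ring
    have t2 : ∑ i, ∑ j, ∑ k, ∑ l, (d i * d j * d k * d l) * (if k = i then if l = j then 1 else 0 else 0)
        = (∑ i, d i ^ 2) ^ 2 := by
      rw [sq, Finset.sum_mul_sum]
      refine Finset.sum_congr rfl fun i _ => Finset.sum_congr rfl fun j _ => ?_
      simp only [mul_ite, mul_one, mul_zero]
      rw [Finset.sum_eq_single i (by intro b _ hb; simp [hb]) (by simp)]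
      simp
      ring
    have t3 : ∑ i, ∑ j, ∑ k, ∑ l, (d i * d j * d k * d l) * (if l = i then if k = j then 1 else 0 else 0)
        = (∑ i, d i ^ 2) ^ 2 := by
      rw [sq, Finset.sum_mul_sum]
      refine Finset.sum_congr rfl fun i _ => Finset.sum_congr rfl fun j _ => ?_
      simp only [mul_ite, mul_one, mul_zero]
      rw [Finset.sum_eq_single j (by intro b _ hb; simp [hb]) (by simp)]
      simp
      ring
    have t4 : ∑ i, ∑ j, ∑ k, ∑ l, (d i * d j * d k * d l) * (if j = i then if k = i then if l = i then 1 else 0 else 0 else 0)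
        = ∑ i, d i ^ 4 := by
      refine Finset.sum_congr rfl fun i _ => ?_
      simp only [mul_ite, mul_one, mul_zero]
      rw [Finset.sum_eq_single i (by intro b _ hb; simp [hb]) (by simp)]
      rw [Finset.sum_eq_single i (by intro b _ hb; simp [hb]) (by simp)]
      simp
      ring
    have : 3 * c * (∑ i, d i ^ 2) ^ 2 = c * (∑ i, d i ^ 2) ^ 2 + c * (∑ i, d i ^ 2) ^ 2 + c * (∑ i, d i ^ 2) ^ 2 := by ring
    rw [this, ← t4]
    nth_rewrite 1 [← t1]
    nth_rewrite 1 [← t2]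
    rw [← t3]
    simp_rw [Finset.mul_sum, ← Finset.sum_add_distrib]
    refine Finset.sum_congr rfl fun i _ => Finset.sum_congr rfl fun j _ =>
      Finset.sum_congr rfl fun k _ => Finset.sum_congr rfl fun l _ => by ring
  rw [e3, hd]
  have h4 : (3 / (n * (n + 2)) - 3 * c : ℝ) ≤ 0 := by
    have : (3 / (n * (n + 2)) - 3 * c : ℝ) = - (6 / ((n - 1) * n * (n + 2))) := by
      rw [hcdef]; field_simp; ring
    rw [this, neg_nonpos]
    positivity
  have h5 : 3 * c * (n : ℝ) ^ 2 = 3 + 6 / (((n : ℝ) - 1) * (n + 2)) := by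
    rw [hcdef]; field_simp; ring
  have h6 : 0 ≤ ∑ i, d i ^ 4 := Finset.sum_nonneg fun i _ => by positivity
  nlinarith [mul_nonpos_of_nonpos_of_nonneg h4 h6]

end moments

section ibp
variable {n : ℕ}

lemma ibp_abstract (μ : Measure (Matrix.orthogonalGroup (Fin n) ℝ)) [IsProbabilityMeasure μ]
    {W p q : Matrix.orthogonalGroup (Fin n) ℝ → ℝ} (hW : Continuous W) (hp : Continuous p) (hq : Continuous q)
    {f f' : ℝ → ℝ} (hf : ∀ x, HasDerivAt f (f' x) x) (hf' : Continuous f')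
    (h : ∀ t : ℝ, ∫ M, f (W M + (Real.cos t - 1) * p M + Real.sin t * q M) *
      (-Real.sin t * p M + Real.cos t * q M) ∂μ = ∫ M, f (W M) * q M ∂μ) :
    ∫ M, f' (W M) * q M ^ 2 ∂μ = ∫ M, f (W M) * p M ∂μ := by
  have hfc : Continuous f := continuous_iff_continuousAt.2 fun x => (hf x).continuousAt
  set F : ℝ → Matrix.orthogonalGroup (Fin n) ℝ → ℝ := fun t M =>
    f (W M + (Real.cos t - 1) * p M + Real.sin t * q M) * (-Real.sin t * p M + Real.cos t * q M) with hF
  set F' : ℝ → Matrix.orthogonalGroup (Fin n) ℝ → ℝ := fun t M =>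
    f' (W M + (Real.cos t - 1) * p M + Real.sin t * q M) * (-Real.sin t * p M + Real.cos t * q M)
      * (-Real.sin t * p M + Real.cos t * q M)
     + f (W M + (Real.cos t - 1) * p M + Real.sin t * q M) * (-Real.cos t * p M + -Real.sin t * q M) with hF'
  have hF'c : Continuous (fun z : ℝ × Matrix.orthogonalGroup (Fin n) ℝ => F' z.1 z.2) := by
    simp only [hF']
    fun_prop
  obtain ⟨C, hC⟩ := (isCompact_Icc (a := (-1 : ℝ)) (b := 1)).prod
    (isCompact_univ (X := Matrix.orthogonalGroup (Fin n) ℝ)) |>.exists_bound_of_continuousOn hF'c.continuousOn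
  have key := hasDerivAt_integral_of_dominated_loc_of_deriv_le (μ := μ) (F := F) (F' := F') (x₀ := (0 : ℝ))
    (s := Set.Icc (-1 : ℝ) 1) (bound := fun _ => C) (Icc_mem_nhds (by norm_num) (by norm_num))
    (Filter.Eventually.of_forall fun t => (og_integrable μ (by simp only [hF]; fun_prop)).aestronglyMeasurable)
    (og_integrable μ (by simp only [hF]; fun_prop))
    (og_integrable μ (by simp only [hF']; fun_prop)).aestronglyMeasurable
    (Filter.Eventually.of_forall fun M t ht => hC (t, M) ⟨ht, Set.mem_univ _⟩)
    (integrable_const C)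
    (Filter.Eventually.of_forall fun M t ht => by
      have h1 : HasDerivAt (fun t => W M + (Real.cos t - 1) * p M + Real.sin t * q M)
          (-Real.sin t * p M + Real.cos t * q M) t := by
        have := (((Real.hasDerivAt_cos t).sub_const 1).mul_const (p M)).const_add (W M) |>.add
          ((Real.hasDerivAt_sin t).mul_const (q M))
        exact this
      have h2 : HasDerivAt (fun t => -Real.sin t * p M + Real.cos t * q M)
          (-Real.cos t * p M + -Real.sin t * q M) t :=
        ((Real.hasDerivAt_sin t).neg.mul_const (p M)).add ((Real.hasDerivAt_cos t).mul_const (q M))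
      exact ((hf _).comp t h1).mul h2)
  have hconst : (fun t => ∫ M, F t M ∂μ) = fun _ => ∫ M, f (W M) * q M ∂μ := funext h
  have h0 := key.2
  rw [hconst] at h0
  have h1 := h0.unique (hasDerivAt_const _ _)
  have e : ∀ M, F' 0 M = f' (W M) * q M ^ 2 - f (W M) * p M := by
    intro M
    simp [hF']
    ring
  simp_rw [e] at h1
  rw [integral_sub (og_integrable μ (by fun_prop)) (og_integrable μ (by fun_prop))] at h1
  linarith

lemma ibp_pair (μ : Measure (Matrix.orthogonalGroup (Fin n) ℝ)) [μ.IsHaarMeasure] [IsProbabilityMeasure μ]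
    (A : Matrix (Fin n) (Fin n) ℝ)
    {f f' : ℝ → ℝ} (hf : ∀ x, HasDerivAt f (f' x) x) (hf' : Continuous f') {i k : Fin n} (hik : i ≠ k) :
    ∫ M : Matrix.orthogonalGroup (Fin n) ℝ, f' (A * (M : Matrix (Fin n) (Fin n) ℝ)).trace *
      (((M : Matrix (Fin n) (Fin n) ℝ) * A) k i - ((M : Matrix (Fin n) (Fin n) ℝ) * A) i k) ^ 2 ∂μ
     = ∫ M : Matrix.orthogonalGroup (Fin n) ℝ, f (A * (M : Matrix (Fin n) (Fin n) ℝ)).trace *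
      (((M : Matrix (Fin n) (Fin n) ℝ) * A) i i + ((M : Matrix (Fin n) (Fin n) ℝ) * A) k k) ∂μ := by
  have hS : ∀ a b, Continuous (fun M : Matrix.orthogonalGroup (Fin n) ℝ => ((M : Matrix (Fin n) (Fin n) ℝ) * A) a b) :=
    fun a b => (og_cont.matrix_mul continuous_const).matrix_elem a b
  refine ibp_abstract μ (W := fun M => (A * (M : Matrix (Fin n) (Fin n) ℝ)).trace)
    (p := fun M => ((M : Matrix (Fin n) (Fin n) ℝ) * A) i i + ((M : Matrix (Fin n) (Fin n) ℝ) * A) k k)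
    (q := fun M => ((M : Matrix (Fin n) (Fin n) ℝ) * A) k i - ((M : Matrix (Fin n) (Fin n) ℝ) * A) i k)
    (continuous_const.matrix_mul og_cont).matrix_trace ((hS i i).add (hS k k)) ((hS k i).sub (hS i k)) hf hf' fun t => ?_
  rw [← og_left μ (fun M => f (A * (M : Matrix (Fin n) (Fin n) ℝ)).trace *
    (((M : Matrix (Fin n) (Fin n) ℝ) * A) k i - ((M : Matrix (Fin n) (Fin n) ℝ) * A) i k)) (rot hik t)]
  refine integral_congr_ae (Filter.Eventually.of_forall fun M => ?_)
  have hc : ((rot hik t * M : Matrix.orthogonalGroup (Fin n) ℝ) : Matrix (Fin n) (Fin n) ℝ)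
    = rotMat i k t * (M : Matrix (Fin n) (Fin n) ℝ) := rfl
  simp only [hc]
  rw [Matrix.trace_mul_comm A (rotMat i k t * _), Matrix.mul_assoc, Matrix.trace_mul_comm A]
  generalize (M : Matrix (Fin n) (Fin n) ℝ) * A = S
  have htr : (rotMat i k t * S).trace = S.trace + (Real.cos t - 1) * (S i i + S k k) + Real.sin t * (S k i - S i k) := by
    simp only [Matrix.trace, Matrix.diag, rotMat_mul_apply, Finset.sum_add_distrib, ← Finset.mul_sum,
      Finset.sum_sub_distrib]
    simp
  rw [htr, rotMat_mul_apply, rotMat_mul_apply]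
  simp only [hik, hik.symm, if_true, if_false]
  ring

lemma ibp_full (μ : Measure (Matrix.orthogonalGroup (Fin n) ℝ)) [μ.IsHaarMeasure] [IsProbabilityMeasure μ]
    (A : Matrix (Fin n) (Fin n) ℝ) (hA : (A * Aᵀ).trace = (n : ℝ))
    {f f' : ℝ → ℝ} (hf : ∀ x, HasDerivAt f (f' x) x) (hf' : Continuous f') :
    ∫ M : Matrix.orthogonalGroup (Fin n) ℝ, f' (A * (M : Matrix (Fin n) (Fin n) ℝ)).trace *
      (n - ((M : Matrix (Fin n) (Fin n) ℝ) * A * ((M : Matrix (Fin n) (Fin n) ℝ) * A)).trace) ∂μ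
     = (n - 1) * ∫ M : Matrix.orthogonalGroup (Fin n) ℝ, f (A * (M : Matrix (Fin n) (Fin n) ℝ)).trace *
      (A * (M : Matrix (Fin n) (Fin n) ℝ)).trace ∂μ := by
  have hfc : Continuous f := continuous_iff_continuousAt.2 fun x => (hf x).continuousAt
  have hS : ∀ a b, Continuous (fun M : Matrix.orthogonalGroup (Fin n) ℝ => ((M : Matrix (Fin n) (Fin n) ℝ) * A) a b) :=
    fun a b => (og_cont.matrix_mul continuous_const).matrix_elem a b
  have hW : Continuous (fun M : Matrix.orthogonalGroup (Fin n) ℝ => (A * (M : Matrix (Fin n) (Fin n) ℝ)).trace) :=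
    (continuous_const.matrix_mul og_cont).matrix_trace
  have hsum : ∑ i, ∑ k ∈ Finset.univ.erase i, ∫ M : Matrix.orthogonalGroup (Fin n) ℝ, f' (A * (M : Matrix (Fin n) (Fin n) ℝ)).trace *
      (((M : Matrix (Fin n) (Fin n) ℝ) * A) k i - ((M : Matrix (Fin n) (Fin n) ℝ) * A) i k) ^ 2 ∂μ
     = ∑ i, ∑ k ∈ Finset.univ.erase i, ∫ M : Matrix.orthogonalGroup (Fin n) ℝ, f (A * (M : Matrix (Fin n) (Fin n) ℝ)).trace *
      (((M : Matrix (Fin n) (Fin n) ℝ) * A) i i + ((M : Matrix (Fin n) (Fin n) ℝ) * A) k k) ∂μ :=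
    Finset.sum_congr rfl fun i _ => Finset.sum_congr rfl fun k hk =>
      ibp_pair μ A hf hf' (Finset.ne_of_mem_erase hk).symm
  have c1 : ∀ i k, Continuous fun M : Matrix.orthogonalGroup (Fin n) ℝ => f' (A * (M : Matrix (Fin n) (Fin n) ℝ)).trace *
      (((M : Matrix (Fin n) (Fin n) ℝ) * A) k i - ((M : Matrix (Fin n) (Fin n) ℝ) * A) i k) ^ 2 :=
    fun i k => (hf'.comp hW).mul (((hS k i).sub (hS i k)).pow 2)
  have c2 : ∀ i k, Continuous fun M : Matrix.orthogonalGroup (Fin n) ℝ => f (A * (M : Matrix (Fin n) (Fin n) ℝ)).trace *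
      (((M : Matrix (Fin n) (Fin n) ℝ) * A) i i + ((M : Matrix (Fin n) (Fin n) ℝ) * A) k k) :=
    fun i k => (hfc.comp hW).mul ((hS i i).add (hS k k))
  have l1 : ∑ i, ∑ k ∈ Finset.univ.erase i, ∫ M : Matrix.orthogonalGroup (Fin n) ℝ, f' (A * (M : Matrix (Fin n) (Fin n) ℝ)).trace *
      (((M : Matrix (Fin n) (Fin n) ℝ) * A) k i - ((M : Matrix (Fin n) (Fin n) ℝ) * A) i k) ^ 2 ∂μ
      = ∫ M : Matrix.orthogonalGroup (Fin n) ℝ, 2 * (f' (A * (M : Matrix (Fin n) (Fin n) ℝ)).trace *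
      (n - ((M : Matrix (Fin n) (Fin n) ℝ) * A * ((M : Matrix (Fin n) (Fin n) ℝ) * A)).trace)) ∂μ := by
    simp_rw [fun i => (integral_finsetSum (μ := μ) (Finset.univ.erase i) (fun k _ => og_integrable μ (c1 i k))).symm]
    rw [← integral_finsetSum _ (fun i _ => og_integrable μ (continuous_finsetSum _ fun k _ => c1 i k))]
    refine integral_congr_ae (Filter.Eventually.of_forall fun M => ?_)
    simp only
    have hSS : (((M : Matrix (Fin n) (Fin n) ℝ) * A) * ((M : Matrix (Fin n) (Fin n) ℝ) * A)ᵀ).trace = n := by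
      rw [Matrix.transpose_mul, Matrix.mul_assoc, Matrix.trace_mul_comm, Matrix.mul_assoc, Matrix.mul_assoc,
        og_transpose_mul, Matrix.mul_one, hA]
    generalize (M : Matrix (Fin n) (Fin n) ℝ) * A = S at hSS ⊢
    simp_rw [← Finset.mul_sum]
    have e1 : ∑ i, ∑ k ∈ Finset.univ.erase i, (S k i - S i k) ^ 2 = ∑ i, ∑ k, (S k i - S i k) ^ 2 := by
      refine Finset.sum_congr rfl fun i _ => ?_
      rw [← Finset.add_sum_erase _ _ (Finset.mem_univ i)]
      simp
    have e2 : (S * Sᵀ).trace = ∑ i, ∑ k, S i k ^ 2 := by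
      simp [Matrix.trace, Matrix.mul_apply, sq]
    have e3 : (S * S).trace = ∑ i, ∑ k, S i k * S k i := by
      simp [Matrix.trace, Matrix.mul_apply]
    have e4 : ∑ i, ∑ k, (S k i - S i k) ^ 2 = 2 * ∑ i, ∑ k, S i k ^ 2 - 2 * ∑ i, ∑ k, S i k * S k i := by
      have : ∑ i, ∑ k, S k i ^ 2 = ∑ i, ∑ k, S i k ^ 2 := Finset.sum_comm
      rw [two_mul]
      nth_rewrite 1 [← this]
      simp_rw [Finset.mul_sum, ← Finset.sum_add_distrib, ← Finset.sum_sub_distrib]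
      exact Finset.sum_congr rfl fun i _ => Finset.sum_congr rfl fun k _ => by ring
    rw [e1, e4, ← e2, ← e3, hSS]
    ring
  have l2 : ∑ i, ∑ k ∈ Finset.univ.erase i, ∫ M : Matrix.orthogonalGroup (Fin n) ℝ, f (A * (M : Matrix (Fin n) (Fin n) ℝ)).trace *
      (((M : Matrix (Fin n) (Fin n) ℝ) * A) i i + ((M : Matrix (Fin n) (Fin n) ℝ) * A) k k) ∂μ
      = ∫ M : Matrix.orthogonalGroup (Fin n) ℝ, (2 * (n - 1)) * (f (A * (M : Matrix (Fin n) (Fin n) ℝ)).trace *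
      (A * (M : Matrix (Fin n) (Fin n) ℝ)).trace) ∂μ := by
    simp_rw [fun i => (integral_finsetSum (μ := μ) (Finset.univ.erase i) (fun k _ => og_integrable μ (c2 i k))).symm]
    rw [← integral_finsetSum _ (fun i _ => og_integrable μ (continuous_finsetSum _ fun k _ => c2 i k))]
    refine integral_congr_ae (Filter.Eventually.of_forall fun M => ?_)
    simp only
    rw [Matrix.trace_mul_comm A]
    generalize (M : Matrix (Fin n) (Fin n) ℝ) * A = S
    simp_rw [← Finset.mul_sum]
    have e1 : ∑ i, ∑ k ∈ Finset.univ.erase i, (S i i + S k k) = 2 * (n - 1) * S.trace := by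
      have : ∀ i : Fin n, ∑ k ∈ Finset.univ.erase i, (S i i + S k k) = (n - 2) * S i i + S.trace := by
        intro i
        have h1 : ∑ k, (S i i + S k k) = n * S i i + S.trace := by
          simp [Finset.sum_add_distrib, Matrix.trace]
        rw [← Finset.add_sum_erase _ _ (Finset.mem_univ i)] at h1
        linarith
      simp_rw [this, Finset.sum_add_distrib, ← Finset.mul_sum]
      simp [Matrix.trace]
      ring
    rw [e1]
    ring
  rw [l1, l2, integral_const_mul, integral_const_mul] at hsum
  linarith

end ibp

section stein

lemma stein_tail_pos (g : ℝ → ℝ) (hg : ∀ t, |g t| ≤ Real.exp (-t ^ 2 / 2)) (x : ℝ) (hx : 0 ≤ x)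
    (hgi : Integrable g) :
    |x * ∫ t in Set.Ioi x, g t| ≤ Real.exp (-x ^ 2 / 2) := by
  have hi : Integrable (fun t : ℝ => t * Real.exp (-t ^ 2 / 2)) := by
    have := integrable_mul_exp_neg_mul_sq (b := 1 / 2) (by norm_num)
    refine this.congr (Filter.Eventually.of_forall fun t => ?_)
    simp only
    congr 2
    ring
  have hI : ∫ t in Set.Ioi x, t * Real.exp (-t ^ 2 / 2) = Real.exp (-x ^ 2 / 2) := by
    have := integral_Ioi_of_hasDerivAt_of_tendsto' (a := x) (f := fun t => - Real.exp (-t ^ 2 / 2))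
      (f' := fun t => t * Real.exp (-t ^ 2 / 2)) (m := 0) ?_ hi.integrableOn ?_
    · rw [this]; simp
    · intro t _
      have h1 : HasDerivAt (fun t : ℝ => -t ^ 2 / 2) (-t) t := by
        have := ((hasDerivAt_pow 2 t).neg).div_const 2
        exact this.congr_deriv (by simp; ring)
      exact h1.exp.neg.congr_deriv (by ring)
    · rw [← neg_zero]
      refine Filter.Tendsto.neg ?_
      refine Real.tendsto_exp_atBot.comp ?_
      have h2 : Filter.Tendsto (fun t : ℝ => t ^ 2 / 2) Filter.atTop Filter.atTop :=
        (Filter.tendsto_pow_atTop (by norm_num)).atTop_div_const (by norm_num)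
      refine (Filter.tendsto_neg_atTop_atBot.comp h2).congr fun t => ?_
      simp [neg_div]
  rw [← integral_const_mul, ← hI]
  refine (abs_integral_le_integral_abs).trans ?_
  refine setIntegral_mono_on (hgi.const_mul x).abs.integrableOn hi.integrableOn measurableSet_Ioi fun t ht => ?_
  rw [abs_mul, abs_of_nonneg hx]
  exact mul_le_mul (le_of_lt ht) (hg t) (abs_nonneg _) (hx.trans (le_of_lt ht))

lemma stein_tail_neg (g : ℝ → ℝ) (hg : ∀ t, |g t| ≤ Real.exp (-t ^ 2 / 2)) (x : ℝ) (hx : x ≤ 0)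
    (hgi : Integrable g) :
    |x * ∫ t in Set.Iic x, g t| ≤ Real.exp (-x ^ 2 / 2) := by
  have h := stein_tail_pos (fun t => g (-t)) (fun t => by simpa using hg (-t)) (-x) (by linarith) hgi.comp_neg
  rw [integral_comp_neg_Ioi] at h
  simpa using h

lemma stein_solution (h : ℝ → ℝ) (hc : Continuous h) (h0 : ∀ x, 0 ≤ h x) (h1 : ∀ x, h x ≤ 1) :
    ∃ f f' : ℝ → ℝ, (∀ x, HasDerivAt f (f' x) x) ∧ Continuous f' ∧ (∀ x, |f' x| ≤ 2) ∧
      ∀ x, f' x - f x * x = h x - ∫ y, h y ∂(gaussianReal 0 1) := by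
  set m := ∫ y, h y ∂(gaussianReal 0 1) with hm
  have hhi : Integrable h (gaussianReal 0 1) := by
    refine (integrable_const (1 : ℝ)).mono' hc.aestronglyMeasurable (Filter.Eventually.of_forall fun x => ?_)
    rw [Real.norm_eq_abs, abs_of_nonneg (h0 x)]
    exact h1 x
  have hm0 : 0 ≤ m := integral_nonneg h0
  have hm1 : m ≤ 1 := by
    have := integral_mono hhi (integrable_const (1 : ℝ)) h1
    simpa using this
  have hab : ∀ x, |h x - m| ≤ 1 := fun x => abs_le.2 ⟨by linarith [h0 x], by linarith [h1 x]⟩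
  set g : ℝ → ℝ := fun t => (h t - m) * Real.exp (-t ^ 2 / 2) with hg
  have hgc : Continuous g := by fun_prop
  have hgb : ∀ t, |g t| ≤ Real.exp (-t ^ 2 / 2) := by
    intro t
    rw [hg, abs_mul, abs_of_pos (Real.exp_pos _)]
    exact mul_le_of_le_one_left (Real.exp_pos _).le (hab t)
  have hei : Integrable (fun t : ℝ => Real.exp (-t ^ 2 / 2)) := by
    have := integrable_exp_neg_mul_sq (b := 1 / 2) (by norm_num)
    refine this.congr (Filter.Eventually.of_forall fun t => ?_)
    simp only
    congr 1
    ring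
  have hgi : Integrable g := hei.mono' hgc.aestronglyMeasurable (Filter.Eventually.of_forall hgb)
  have hg0 : ∫ t, g t = 0 := by
    have e : ∫ y, (h y - m) ∂(gaussianReal 0 1) = 0 := by
      rw [integral_sub hhi (integrable_const m)]
      simp [hm]
    rw [integral_gaussianReal_eq_integral_smul (by norm_num)] at e
    have e2 : ∀ t, gaussianPDFReal 0 1 t • (h t - m) = (√(2 * Real.pi))⁻¹ * g t := by
      intro t
      simp [gaussianPDFReal, hg]
      ring
    simp_rw [e2] at e
    rw [integral_const_mul] at e
    rcases mul_eq_zero.1 e with h | h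
    · exfalso
      have : 0 < (√(2 * Real.pi))⁻¹ := by positivity
      linarith
    · exact h
  set f : ℝ → ℝ := fun x => Real.exp (x ^ 2 / 2) * ∫ t in Set.Iic x, g t with hf
  have hGd : ∀ x, HasDerivAt (fun x => ∫ t in Set.Iic x, g t) (g x) x := by
    intro x
    have e : (fun x => ∫ t in Set.Iic x, g t) = fun x => (∫ t in Set.Iic (0 : ℝ), g t) + ∫ t in (0 : ℝ)..x, g t := by
      ext y
      rw [← intervalIntegral.integral_Iic_sub_Iic hgi.integrableOn hgi.integrableOn]
      ring
    rw [e]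
    exact (hgc.integral_hasStrictDerivAt 0 x).hasDerivAt.const_add _
  have hfd : ∀ x, HasDerivAt f (f x * x + (h x - m)) x := by
    intro x
    have h2 : HasDerivAt (fun t : ℝ => t ^ 2 / 2) x x := by
      have := (hasDerivAt_pow 2 x).div_const 2
      exact this.congr_deriv (by simp)
    refine (h2.exp.mul (hGd x)).congr_deriv ?_
    have : Real.exp (x ^ 2 / 2) * Real.exp (-x ^ 2 / 2) = 1 := by
      rw [← Real.exp_add, ← Real.exp_zero]
      congr 1
      ring
    have hgx : g x = (h x - m) * Real.exp (-x ^ 2 / 2) := rfl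
    have hfx : f x = Real.exp (x ^ 2 / 2) * ∫ t in Set.Iic x, g t := rfl
    rw [hgx, hfx]
    linear_combination (h x - m) * this
  have hfc : Continuous f := continuous_iff_continuousAt.2 fun x => (hfd x).continuousAt
  refine ⟨f, fun x => f x * x + (h x - m), hfd, by fun_prop, ?_, fun x => by ring⟩
  intro x
  have hb : |f x * x| ≤ 1 := by
    have k : |x * ∫ t in Set.Iic x, g t| ≤ Real.exp (-x ^ 2 / 2) := by
      rcases le_total 0 x with hx | hx
      · have e : ∫ t in Set.Iic x, g t = - ∫ t in Set.Ioi x, g t := by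
          have := intervalIntegral.integral_Iic_add_Ioi (b := x) hgi.integrableOn hgi.integrableOn
          rw [hg0] at this
          linarith
        rw [e, mul_neg, abs_neg]
        exact stein_tail_pos g hgb x hx hgi
      · exact stein_tail_neg g hgb x hx hgi
    have : f x * x = Real.exp (x ^ 2 / 2) * (x * ∫ t in Set.Iic x, g t) := by simp only [hf]; ring
    rw [this, abs_mul, abs_of_pos (Real.exp_pos _)]
    calc _ ≤ Real.exp (x ^ 2 / 2) * Real.exp (-x ^ 2 / 2) := by gcongr
      _ = 1 := by
        rw [← Real.exp_add, ← Real.exp_zero]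
        congr 1
        ring
  calc |f x * x + (h x - m)| ≤ |f x * x| + |h x - m| := abs_add_le _ _
    _ ≤ 2 := by linarith [hab x]

/-- Passing from continuous test functions to measurable sets. -/
lemma tv_of_continuous (ν γ : Measure ℝ) [IsProbabilityMeasure ν] [IsProbabilityMeasure γ] (c : ℝ)
    (H : ∀ h : ℝ → ℝ, Continuous h → (∀ x, 0 ≤ h x) → (∀ x, h x ≤ 1) →
      |∫ x, h x ∂ν - ∫ x, h x ∂γ| ≤ c) (s : Set ℝ) (hs : MeasurableSet s) :
    |(ν s).toReal - (γ s).toReal| ≤ c := by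
  have hcl : ∀ F : Set ℝ, IsClosed F → |(ν F).toReal - (γ F).toReal| ≤ c := by
    intro F hF
    have hδ : ∀ k : ℕ, 0 < (1 : ℝ) / (k + 1) := fun k => by positivity
    have hl : Filter.Tendsto (fun k : ℕ => (1 : ℝ) / (k + 1)) Filter.atTop (nhds 0) :=
      tendsto_one_div_add_atTop_nhds_zero_nat
    have t1 := tendsto_integral_thickenedIndicator_of_isClosed ν hF hδ hl
    have t2 := tendsto_integral_thickenedIndicator_of_isClosed γ hF hδ hl
    refine le_of_tendsto (t1.sub t2).abs (Filter.Eventually.of_forall fun k => ?_)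
    refine H _ ?_ ?_ ?_
    · exact NNReal.continuous_coe.comp (thickenedIndicator (hδ k) F).continuous
    · intro x; positivity
    · intro x
      exact_mod_cast thickenedIndicator_le_one (hδ k) F x
  refine le_of_forall_pos_le_add fun ε hε => ?_
  obtain ⟨F, hFs, hF, hlt⟩ := hs.exists_isClosed_sdiff_lt (μ := ν + γ) (measure_ne_top _ _)
    (ε := ENNReal.ofReal ε) (by simpa using hε)
  have e1 : (ν s).toReal = (ν F).toReal + (ν (s \ F)).toReal := by
    have := measureReal_sdiff_add_inter (μ := ν) (s := s) (t := F) hF.measurableSet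
    rw [Set.inter_eq_self_of_subset_right hFs] at this
    simp only [measureReal_def] at this
    linarith
  have e2 : (γ s).toReal = (γ F).toReal + (γ (s \ F)).toReal := by
    have := measureReal_sdiff_add_inter (μ := γ) (s := s) (t := F) hF.measurableSet
    rw [Set.inter_eq_self_of_subset_right hFs] at this
    simp only [measureReal_def] at this
    linarith
  have e3 : (ν (s \ F)).toReal + (γ (s \ F)).toReal < ε := by
    rw [← ENNReal.toReal_add (measure_ne_top _ _) (measure_ne_top _ _)]
    rw [Measure.add_apply] at hlt
    exact (ENNReal.lt_ofReal_iff_toReal_lt (by simp)).1 hlt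
  have p1 : 0 ≤ (ν (s \ F)).toReal := ENNReal.toReal_nonneg
  have p2 : 0 ≤ (γ (s \ F)).toReal := ENNReal.toReal_nonneg
  have := abs_le.1 (hcl F hF)
  rw [e1, e2, abs_le]
  constructor <;> linarith

end stein

section svd
variable {n : ℕ}

lemma svd_rows (B : Matrix (Fin n) (Fin n) ℝ) (hB : ∀ i j, i ≠ j → (B * Bᵀ) i j = 0) :
    ∃ (d : Fin n → ℝ) (V : Matrix.orthogonalGroup (Fin n) ℝ),
      B = Matrix.diagonal d * (V : Matrix (Fin n) (Fin n) ℝ) := by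
  set b : Fin n → EuclideanSpace ℝ (Fin n) := fun i => WithLp.toLp 2 (B i) with hb
  have hin : ∀ i j, i ≠ j → inner ℝ (b i) (b j) = 0 := by
    intro i j hij
    have := hB j i hij.symm
    simp only [hb, PiLp.inner_apply]
    simpa [Matrix.mul_apply] using this
  obtain ⟨e, he⟩ := Orthonormal.exists_orthonormalBasis_extension_of_card_eq (𝕜 := ℝ)
    (E := EuclideanSpace ℝ (Fin n)) (ι := Fin n) (by simp) (v := fun i => (‖b i‖)⁻¹ • b i) (s := {i | b i ≠ 0}) (by
      constructor
      · rintro ⟨i, hi⟩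
        simp only [Set.domRestrict_apply, norm_smul, norm_inv, norm_norm]
        exact inv_mul_cancel₀ (norm_ne_zero_iff.2 hi)
      · rintro ⟨i, hi⟩ ⟨j, hj⟩ hij
        have : i ≠ j := fun h => hij (Subtype.ext h)
        simp [inner_smul_left, inner_smul_right, hin i j this])
  refine ⟨fun i => ‖b i‖, ⟨Matrix.of fun i j => e i j, ?_⟩, ?_⟩
  · rw [Matrix.mem_orthogonalGroup_iff]
    change (Matrix.of fun i j => e i j) * (Matrix.of fun i j => e i j)ᵀ = 1
    ext i j
    have := orthonormal_iff_ite.1 e.orthonormal j i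
    rw [PiLp.inner_apply] at this
    simp only [Matrix.mul_apply, Matrix.one_apply, Matrix.transpose_apply, Matrix.of_apply]
    simp only [RCLike.inner_apply, conj_trivial] at this
    rw [this]
    simp [eq_comm]
  · ext i j
    rw [Matrix.diagonal_mul]
    simp only [Matrix.of_apply]
    by_cases hi : b i = 0
    · have h0 : B i j = 0 := by
        have := congrArg (fun v : EuclideanSpace ℝ (Fin n) => v j) hi
        simpa [hb] using this
      rw [hi, h0]; simp
    · rw [he i hi]
      have : ‖b i‖ ≠ 0 := norm_ne_zero_iff.2 hi
      simp only [PiLp.smul_apply, smul_eq_mul]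
      rw [mul_inv_cancel_left₀ this]

lemma svd_exists (A : Matrix (Fin n) (Fin n) ℝ) :
    ∃ (U V : Matrix.orthogonalGroup (Fin n) ℝ) (d : Fin n → ℝ),
      A = (U : Matrix (Fin n) (Fin n) ℝ) * Matrix.diagonal d * (V : Matrix (Fin n) (Fin n) ℝ) := by
  have hH : (A * Aᵀ).IsHermitian := by
    have := Matrix.isHermitian_mul_conjTranspose_self A
    simpa [Matrix.conjTranspose_eq_transpose_of_trivial] using this
  set U : Matrix.orthogonalGroup (Fin n) ℝ := hH.eigenvectorUnitary with hU
  have hsp : A * Aᵀ = (U : Matrix (Fin n) (Fin n) ℝ) * Matrix.diagonal hH.eigenvalues * (U : Matrix (Fin n) (Fin n) ℝ)ᵀ := by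
    have := hH.spectral_theorem
    rw [Unitary.conjStarAlgAut_apply] at this
    exact this
  have hB : ((U : Matrix (Fin n) (Fin n) ℝ)ᵀ * A) * ((U : Matrix (Fin n) (Fin n) ℝ)ᵀ * A)ᵀ = Matrix.diagonal hH.eigenvalues := by
    rw [Matrix.transpose_mul, Matrix.transpose_transpose]
    calc _ = (U : Matrix (Fin n) (Fin n) ℝ)ᵀ * (A * Aᵀ) * (U : Matrix (Fin n) (Fin n) ℝ) := by
          simp only [Matrix.mul_assoc]
      _ = ((U : Matrix (Fin n) (Fin n) ℝ)ᵀ * (U : Matrix (Fin n) (Fin n) ℝ)) * Matrix.diagonal hH.eigenvalues *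
          ((U : Matrix (Fin n) (Fin n) ℝ)ᵀ * (U : Matrix (Fin n) (Fin n) ℝ)) := by
          have := congrArg (fun X => (U : Matrix (Fin n) (Fin n) ℝ)ᵀ * X * (U : Matrix (Fin n) (Fin n) ℝ)) hsp
          simp only [Matrix.mul_assoc] at this ⊢
          exact this
      _ = _ := by rw [og_transpose_mul, Matrix.one_mul, Matrix.mul_one]
  obtain ⟨d, V, hV⟩ := svd_rows ((U : Matrix (Fin n) (Fin n) ℝ)ᵀ * A) (fun i j hij => by
    rw [hB, Matrix.diagonal_apply_ne _ hij])
  refine ⟨U, V, d, ?_⟩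
  rw [Matrix.mul_assoc, ← hV, ← Matrix.mul_assoc, og_mul_transpose, Matrix.one_mul]

end svd

section final
variable {n : ℕ}

lemma trace_moments (μ : Measure (Matrix.orthogonalGroup (Fin n) ℝ)) [μ.IsHaarMeasure] [IsProbabilityMeasure μ]
    (hn : 2 ≤ n) (A : Matrix (Fin n) (Fin n) ℝ) (hA : (A * Aᵀ).trace = (n : ℝ)) :
    ∫ M : Matrix.orthogonalGroup (Fin n) ℝ,
      ((M : Matrix (Fin n) (Fin n) ℝ) * A * ((M : Matrix (Fin n) (Fin n) ℝ) * A)).trace ∂μ = 1 ∧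
    ∫ M : Matrix.orthogonalGroup (Fin n) ℝ,
      ((M : Matrix (Fin n) (Fin n) ℝ) * A * ((M : Matrix (Fin n) (Fin n) ℝ) * A)).trace ^ 2 ∂μ
      ≤ 3 + 6 / (((n : ℝ) - 1) * (n + 2)) := by
  obtain ⟨U, V, d, hUV⟩ := svd_exists A
  have hd : ∑ i, d i ^ 2 = n := by
    rw [← hA, hUV]
    simp only [Matrix.transpose_mul, Matrix.diagonal_transpose]
    have : (U : Matrix (Fin n) (Fin n) ℝ) * Matrix.diagonal d * (V : Matrix (Fin n) (Fin n) ℝ) *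
        ((V : Matrix (Fin n) (Fin n) ℝ)ᵀ * (Matrix.diagonal d * (U : Matrix (Fin n) (Fin n) ℝ)ᵀ))
        = (U : Matrix (Fin n) (Fin n) ℝ) * (Matrix.diagonal d * Matrix.diagonal d * (U : Matrix (Fin n) (Fin n) ℝ)ᵀ) := by
      calc _ = (U : Matrix (Fin n) (Fin n) ℝ) * Matrix.diagonal d * ((V : Matrix (Fin n) (Fin n) ℝ) *
        (V : Matrix (Fin n) (Fin n) ℝ)ᵀ) * (Matrix.diagonal d * (U : Matrix (Fin n) (Fin n) ℝ)ᵀ) := by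
            simp only [Matrix.mul_assoc]
        _ = _ := by rw [og_mul_transpose, Matrix.mul_one]; simp only [Matrix.mul_assoc]
    rw [this, Matrix.trace_mul_comm, Matrix.mul_assoc, og_transpose_mul, Matrix.mul_one,
      Matrix.diagonal_mul_diagonal, Matrix.trace_diagonal]
    simp [sq]
  set T : Matrix.orthogonalGroup (Fin n) ℝ → ℝ := fun M => ∑ i, ∑ j, d i * d j * (ent M i j * ent M j i) with hT
  have key : ∀ M : Matrix.orthogonalGroup (Fin n) ℝ,
      ((M : Matrix (Fin n) (Fin n) ℝ) * A * ((M : Matrix (Fin n) (Fin n) ℝ) * A)).trace = T (V * M * U) := by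
    intro M
    have e1 : T (V * M * U) = ((Matrix.diagonal d * ((V * M * U : Matrix.orthogonalGroup (Fin n) ℝ) : Matrix (Fin n) (Fin n) ℝ)) *
      (Matrix.diagonal d * ((V * M * U : Matrix.orthogonalGroup (Fin n) ℝ) : Matrix (Fin n) (Fin n) ℝ))).trace := by
      simp only [hT, Matrix.trace, Matrix.diag, Matrix.mul_apply (M := Matrix.diagonal d * _), Matrix.diagonal_mul, ent]
      exact Finset.sum_congr rfl fun i _ => Finset.sum_congr rfl fun j _ => by ring
    rw [e1]
    have e2 : ((V * M * U : Matrix.orthogonalGroup (Fin n) ℝ) : Matrix (Fin n) (Fin n) ℝ) =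
      (V : Matrix (Fin n) (Fin n) ℝ) * (M : Matrix (Fin n) (Fin n) ℝ) * (U : Matrix (Fin n) (Fin n) ℝ) := rfl
    rw [e2, hUV]
    have e3 : (M : Matrix (Fin n) (Fin n) ℝ) * ((U : Matrix (Fin n) (Fin n) ℝ) * Matrix.diagonal d * (V : Matrix (Fin n) (Fin n) ℝ)) *
      ((M : Matrix (Fin n) (Fin n) ℝ) * ((U : Matrix (Fin n) (Fin n) ℝ) * Matrix.diagonal d * (V : Matrix (Fin n) (Fin n) ℝ)))
      = ((M : Matrix (Fin n) (Fin n) ℝ) * (U : Matrix (Fin n) (Fin n) ℝ)) * (Matrix.diagonal d * (V : Matrix (Fin n) (Fin n) ℝ) *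
       (M : Matrix (Fin n) (Fin n) ℝ) * (U : Matrix (Fin n) (Fin n) ℝ) * Matrix.diagonal d * (V : Matrix (Fin n) (Fin n) ℝ)) := by
      simp only [Matrix.mul_assoc]
    rw [e3, Matrix.trace_mul_comm]
    simp only [Matrix.mul_assoc]
  have inv : ∀ g : Matrix.orthogonalGroup (Fin n) ℝ → ℝ, ∫ M, g (V * M * U) ∂μ = ∫ M, g M ∂μ := by
    intro g
    rw [og_left μ (fun M => g (M * U)) V, og_right μ g U]
  simp_rw [key]
  rw [inv T, inv (fun M => T M ^ 2)]
  exact ⟨mom_tr_diag μ d hd hn, mom_tr_sq_diag μ d hd hn⟩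

lemma test_bound (μ : Measure (Matrix.orthogonalGroup (Fin n) ℝ)) [μ.IsHaarMeasure] [IsProbabilityMeasure μ]
    (hn : 2 ≤ n) (A : Matrix (Fin n) (Fin n) ℝ) (hA : (A * Aᵀ).trace = (n : ℝ))
    (h : ℝ → ℝ) (hc : Continuous h) (h0 : ∀ x, 0 ≤ h x) (h1 : ∀ x, h x ≤ 1) :
    |∫ M : Matrix.orthogonalGroup (Fin n) ℝ, h (A * (M : Matrix (Fin n) (Fin n) ℝ)).trace ∂μ
      - ∫ y, h y ∂(gaussianReal 0 1)|
      ≤ 2 * Real.sqrt (2 + 6 / (((n : ℝ) - 1) * ((n : ℝ) + 2))) / ((n : ℝ) - 1) := by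
  have hn' : (2 : ℝ) ≤ n := by exact_mod_cast hn
  have hn1 : (0 : ℝ) < n - 1 := by linarith
  obtain ⟨f, f', hf, hf', hb, hst⟩ := stein_solution h hc h0 h1
  have hfc : Continuous f := continuous_iff_continuousAt.2 fun x => (hf x).continuousAt
  have hibp := ibp_full μ A hA hf hf'
  obtain ⟨m1, m2⟩ := trace_moments μ hn A hA
  set W : Matrix.orthogonalGroup (Fin n) ℝ → ℝ := fun M => (A * (M : Matrix (Fin n) (Fin n) ℝ)).trace with hWdef
  set T : Matrix.orthogonalGroup (Fin n) ℝ → ℝ := fun M =>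
    ((M : Matrix (Fin n) (Fin n) ℝ) * A * ((M : Matrix (Fin n) (Fin n) ℝ) * A)).trace with hTdef
  have hW : Continuous W := (continuous_const.matrix_mul og_cont).matrix_trace
  have hT : Continuous T :=
    ((og_cont.matrix_mul continuous_const).matrix_mul (og_cont.matrix_mul continuous_const)).matrix_trace
  change ∫ M, f' (W M) * (n - T M) ∂μ = (n - 1) * ∫ M, f (W M) * W M ∂μ at hibp
  change ∫ M, T M ∂μ = 1 at m1
  change ∫ M, T M ^ 2 ∂μ ≤ _ at m2
  change |∫ M, h (W M) ∂μ - _| ≤ _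
  have hvar : ∫ M, (T M - 1) ^ 2 ∂μ ≤ 2 + 6 / (((n : ℝ) - 1) * ((n : ℝ) + 2)) := by
    have e : ∀ M, (T M - 1) ^ 2 = (T M ^ 2 - 2 * T M) + 1 := fun M => by ring
    simp_rw [e]
    rw [integral_add (og_integrable μ (by fun_prop)) (integrable_const _),
      integral_sub (og_integrable μ (by fun_prop)) (og_integrable μ (by fun_prop)),
      integral_const_mul, m1]
    simp
    linarith
  have habs : ∫ M, |T M - 1| ∂μ ≤ Real.sqrt (2 + 6 / (((n : ℝ) - 1) * ((n : ℝ) + 2))) := by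
    refine Real.le_sqrt_of_sq_le (le_trans ?_ hvar)
    set a := ∫ M, |T M - 1| ∂μ with ha
    have hnn : 0 ≤ ∫ M, (|T M - 1| - a) ^ 2 ∂μ := integral_nonneg fun M => sq_nonneg _
    have e : ∀ M, (|T M - 1| - a) ^ 2 = ((T M - 1) ^ 2 - 2 * a * |T M - 1|) + a ^ 2 := fun M => by
      rw [← sq_abs (T M - 1)]; ring
    simp_rw [e] at hnn
    rw [integral_add (og_integrable μ (by fun_prop)) (integrable_const _),
      integral_sub (og_integrable μ (by fun_prop)) (og_integrable μ (by fun_prop)),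
      integral_const_mul, ← ha] at hnn
    simp at hnn
    nlinarith
  have hmain : ∫ M, h (W M) ∂μ - ∫ y, h y ∂(gaussianReal 0 1) = (∫ M, f' (W M) * (T M - 1) ∂μ) / (n - 1) := by
    have e1 : ∫ M, h (W M) ∂μ - ∫ y, h y ∂(gaussianReal 0 1) = ∫ M, (f' (W M) - f (W M) * W M) ∂μ := by
      simp_rw [hst]
      rw [integral_sub (og_integrable μ (by fun_prop)) (integrable_const _)]
      simp
    rw [e1, integral_sub (og_integrable μ (by fun_prop)) (og_integrable μ (by fun_prop)), eq_div_iff hn1.ne']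
    have e2 : ∀ M, f' (W M) * (T M - 1) = (n - 1) * f' (W M) - f' (W M) * (n - T M) := fun M => by ring
    simp_rw [e2]
    rw [integral_sub (og_integrable μ (by fun_prop)) (og_integrable μ (by fun_prop)), hibp, integral_const_mul]
    ring
  rw [hmain, abs_div, abs_of_pos hn1]
  gcongr
  refine abs_integral_le_integral_abs.trans ?_
  calc ∫ M, |f' (W M) * (T M - 1)| ∂μ ≤ ∫ M, 2 * |T M - 1| ∂μ := by
        refine integral_mono (og_integrable μ (by fun_prop)) (og_integrable μ (by fun_prop)) fun M => ?_
        simp only [abs_mul]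
        exact mul_le_mul_of_nonneg_right (hb _) (abs_nonneg _)
    _ ≤ _ := by
        rw [integral_const_mul]
        linarith

end final

/-- For `tr (A Aᵀ) = n` and `M` Haar-distributed on `O(n)`, the law of
`W = tr (A M)` satisfies `d_TV(W, Z) ≤ 2 √(2 + 6/((n-1)(n+2))) / (n-1)`. -/
theorem tv_bound_trace_orthogonal_refined (n : ℕ) (hn : 2 ≤ n)
    (A : Matrix (Fin n) (Fin n) ℝ) (hA : (A * Aᵀ).trace = (n : ℝ))
    (μ : Measure (Matrix.orthogonalGroup (Fin n) ℝ))
    [μ.IsHaarMeasure] [IsProbabilityMeasure μ] :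
    ∀ s : Set ℝ, MeasurableSet s →
      |((μ.map (fun M : Matrix.orthogonalGroup (Fin n) ℝ =>
            (A * (M : Matrix (Fin n) (Fin n) ℝ)).trace)) s).toReal
          - ((gaussianReal 0 1) s).toReal|
        ≤ 2 * Real.sqrt (2 + 6 / (((n : ℝ) - 1) * ((n : ℝ) + 2))) / ((n : ℝ) - 1) := by
  have hW : Continuous (fun M : Matrix.orthogonalGroup (Fin n) ℝ =>
      (A * (M : Matrix (Fin n) (Fin n) ℝ)).trace) :=
    (continuous_const.matrix_mul og_cont).matrix_trace
  have hp : IsProbabilityMeasure (μ.map (fun M : Matrix.orthogonalGroup (Fin n) ℝ =>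
      (A * (M : Matrix (Fin n) (Fin n) ℝ)).trace)) :=
    Measure.isProbabilityMeasure_map hW.measurable.aemeasurable
  refine tv_of_continuous _ _ _ fun h hc h0 h1 => ?_
  rw [integral_map hW.measurable.aemeasurable hc.aestronglyMeasurable]
  exact test_bound μ hn A hA h hc h0 h1
end

section
/- Let n ≥ 2 and let H = (h_{ij}) be a random matrix in the unitary group U(n) distributed according to Haar probability measure, with entry-wise complex conjugate denoted by a bar. Then for all indices 1 ≤ i, j, k, ℓ ≤ n, E[(h_{i1} h̄_{j2} − h_{i2} h̄_{j1})(h_{k1} h̄_{ℓ2} − h_{k2} h̄_{ℓ1})] = −2 δ_{iℓ} δ_{jk} (1 − δ_{ij}) / ((n−1)(n+1)) + 2 δ_{ij} δ_{kℓ} (1 − δ_{ik}) / ((n−1)n(n+1)) − 2·𝟙{i = j = k = ℓ} / (n(n+1)). -/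
open MeasureTheory ProbabilityTheory Matrix

noncomputable instance {n : ℕ} : MeasurableSpace (Matrix.unitaryGroup (Fin n) ℂ) :=
  borel _

instance {n : ℕ} : BorelSpace (Matrix.unitaryGroup (Fin n) ℂ) := ⟨rfl⟩

/-- General fourth moment of the entries. -/
noncomputable def mom {n : ℕ} (μ : Measure (Matrix.unitaryGroup (Fin n) ℂ))
    (p q r s i k l j : Fin n) : ℂ :=
  ∫ H : Matrix.unitaryGroup (Fin n) ℂ, ((H : Matrix (Fin n) (Fin n) ℂ) i p *
    (H : Matrix (Fin n) (Fin n) ℂ) k q * star ((H : Matrix (Fin n) (Fin n) ℂ) l r) *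
    star ((H : Matrix (Fin n) (Fin n) ℂ) j s)) ∂μ

lemma cont_entry {n : ℕ} (i p : Fin n) :
    Continuous (fun H : Matrix.unitaryGroup (Fin n) ℂ => (H : Matrix (Fin n) (Fin n) ℂ) i p) :=
  (continuous_subtype_val).matrix_elem i p

lemma mom_integrable {n : ℕ} (μ : Measure (Matrix.unitaryGroup (Fin n) ℂ))
    [IsProbabilityMeasure μ] (p q r s i k l j : Fin n) :
    Integrable (fun H : Matrix.unitaryGroup (Fin n) ℂ => (H : Matrix (Fin n) (Fin n) ℂ) i p *
    (H : Matrix (Fin n) (Fin n) ℂ) k q * star ((H : Matrix (Fin n) (Fin n) ℂ) l r) *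
    star ((H : Matrix (Fin n) (Fin n) ℂ) j s)) μ := by
  have hc := @cont_entry n
  refine Integrable.of_bound (C := 1) (Continuous.aestronglyMeasurable ?_) ?_
  · exact (((hc i p).mul (hc k q)).mul (hc l r).star).mul (hc j s).star
  · refine Filter.Eventually.of_forall fun H => ?_
    have hb : ∀ a b, ‖(H : Matrix (Fin n) (Fin n) ℂ) a b‖ ≤ 1 :=
      fun a b => entry_norm_bound_of_unitary H.2 a b
    simp only [norm_mul, norm_star]
    have h1 := mul_le_one₀ (hb i p) (norm_nonneg _) (hb k q)
    have h2 := mul_le_one₀ h1 (norm_nonneg _) (hb l r)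
    exact mul_le_one₀ h2 (norm_nonneg _) (hb j s)

lemma mom_inv {n : ℕ} (μ : Measure (Matrix.unitaryGroup (Fin n) ℂ))
    [μ.IsHaarMeasure] (U : Matrix.unitaryGroup (Fin n) ℂ) (p q r s i k l j : Fin n) :
    mom μ p q r s i k l j = ∫ H : Matrix.unitaryGroup (Fin n) ℂ,
      (((U : Matrix (Fin n) (Fin n) ℂ) * (H : Matrix (Fin n) (Fin n) ℂ)) i p *
      ((U : Matrix (Fin n) (Fin n) ℂ) * (H : Matrix (Fin n) (Fin n) ℂ)) k q *
      star (((U : Matrix (Fin n) (Fin n) ℂ) * (H : Matrix (Fin n) (Fin n) ℂ)) l r) *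
      star (((U : Matrix (Fin n) (Fin n) ℂ) * (H : Matrix (Fin n) (Fin n) ℂ)) j s)) ∂μ := by
  unfold mom
  exact (integral_mul_left_eq_self (μ := μ) (fun H : Matrix.unitaryGroup (Fin n) ℂ =>
    (H : Matrix (Fin n) (Fin n) ℂ) i p *
    (H : Matrix (Fin n) (Fin n) ℂ) k q * star ((H : Matrix (Fin n) (Fin n) ℂ) l r) *
    star ((H : Matrix (Fin n) (Fin n) ℂ) j s)) U).symm

lemma mom_perm {n : ℕ} (μ : Measure (Matrix.unitaryGroup (Fin n) ℂ))
    [μ.IsHaarMeasure] (σ : Equiv.Perm (Fin n)) (p q r s i k l j : Fin n) :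
    mom μ p q r s i k l j = mom μ p q r s (σ i) (σ k) (σ l) (σ j) := by
  have hU : σ.permMatrix ℂ ∈ Matrix.unitaryGroup (Fin n) ℂ := by
    rw [Matrix.mem_unitaryGroup_iff, Matrix.star_eq_conjTranspose, Matrix.conjTranspose_permMatrix,
      ← Matrix.permMatrix_mul]
    simp
  rw [mom_inv μ ⟨_, hU⟩]
  simp [mom, Equiv.Perm.permMatrix, PEquiv.toMatrix_toPEquiv_mul]

lemma mom_diag {n : ℕ} (μ : Measure (Matrix.unitaryGroup (Fin n) ℂ))
    [μ.IsHaarMeasure] (d : Fin n → ℂ) (hd : ∀ i, d i * star (d i) = 1)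
    (p q r s i k l j : Fin n) :
    mom μ p q r s i k l j = (d i * d k * star (d l) * star (d j)) * mom μ p q r s i k l j := by
  have hU : Matrix.diagonal d ∈ Matrix.unitaryGroup (Fin n) ℂ := by
    rw [Matrix.mem_unitaryGroup_iff, Matrix.star_eq_conjTranspose, Matrix.diagonal_conjTranspose,
      Matrix.diagonal_mul_diagonal, ← Matrix.diagonal_one]
    congr 1
    funext i
    exact hd i
  conv_lhs => rw [mom_inv μ ⟨_, hU⟩]
  simp only [Matrix.diagonal_mul, mom]
  rw [← integral_const_mul]
  congr 1
  funext H
  simp only [star_mul']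
  ring

lemma mom_zero {n : ℕ} (μ : Measure (Matrix.unitaryGroup (Fin n) ℂ))
    [μ.IsHaarMeasure] (p q r s i k l j : Fin n)
    (h1 : ¬ (i = l ∧ k = j)) (h2 : ¬ (i = j ∧ k = l)) :
    mom μ p q r s i k l j = 0 := by
  have key : ∀ m, mom μ p q r s i k l j = _ := fun m =>
    mom_diag μ (fun a => if a = m then Complex.I else 1)
    (by intro a; split_ifs <;> simp) p q r s i k l j
  have hI : ∀ z : ℂ, ∀ c : ℂ, c ≠ 1 → z = c * z → z = 0 := by
    intro z c hc h
    have : (1 - c) * z = 0 := by linear_combination h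
    rcases mul_eq_zero.1 this with h | h
    · exact absurd (by linear_combination -h) hc
    · exact h
  have e1 : Complex.I ≠ 1 := by simp [Complex.ext_iff]
  have e2 : -Complex.I ≠ 1 := by simp [Complex.ext_iff]
  have e3 : (-1 : ℂ) ≠ 1 := by norm_num
  have hi := fun h => hI _ _ h (key i)
  have hk := fun h => hI _ _ h (key k)
  have hl := fun h => hI _ _ h (key l)
  have hj := fun h => hI _ _ h (key j)
  by_cases a1 : i = l
  · subst a1
    have : k ≠ j := fun h => h1 ⟨rfl, h⟩
    by_cases hik : i = k
    · subst hik
      apply hi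
      simp [this, this.symm, e1]
    · apply hk
      simp [this, this.symm, hik, e1]
  · by_cases a2 : i = j
    · subst a2
      have : k ≠ l := fun h => h2 ⟨rfl, h⟩
      by_cases hik : i = k
      · subst hik
        apply hi
        simp [this, this.symm, e1]
      · apply hk
        simp [this, this.symm, hik, e1]
    · apply hi
      by_cases hik : k = i
      · simp [hik, Ne.symm a1, Ne.symm a2, e3]
      · simp [hik, Ne.symm a1, Ne.symm a2, e1]

lemma exists_perm {n : ℕ} (a b i k : Fin n) (hab : a ≠ b) (hik : i ≠ k) :
    ∃ σ : Equiv.Perm (Fin n), σ a = i ∧ σ b = k := by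
  refine ⟨Equiv.swap (Equiv.swap a i b) k * Equiv.swap a i, ?_, ?_⟩
  · rw [Equiv.Perm.mul_apply, Equiv.swap_apply_left, Equiv.swap_apply_of_ne_of_ne _ hik]
    intro h
    have := (Equiv.swap a i).injective (a₁ := a) (a₂ := b) (by rw [← h]; simp)
    exact hab this
  · simp

lemma mom_rot {n : ℕ} (μ : Measure (Matrix.unitaryGroup (Fin n) ℂ))
    [μ.IsHaarMeasure] [IsProbabilityMeasure μ] (p q r s a b : Fin n) (hab : a ≠ b) :
    mom μ p q r s a a a a = mom μ p q r s a b a b + mom μ p q r s a b b a := by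
  set v : Fin n → ℂ := Pi.single a (3/5) + Pi.single b (4/5) with hv
  have hsv : star v = v := by
    funext x
    simp [hv, Pi.single_apply]
    split_ifs <;> simp [map_ofNat]
  have hvv : v ⬝ᵥ v = 1 := by
    simp [hv, hab, hab.symm]
    norm_num
  set W : Matrix (Fin n) (Fin n) ℂ := 1 - (2:ℂ) • Matrix.vecMulVec v v with hW
  have hU : W ∈ Matrix.unitaryGroup (Fin n) ℂ := by
    have : star W = W := by
      rw [hW, Matrix.star_eq_conjTranspose]
      simp [Matrix.conjTranspose_vecMulVec, hsv]
    rw [Matrix.mem_unitaryGroup_iff, this, hW]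
    have h2 : Matrix.vecMulVec v v * Matrix.vecMulVec v v = Matrix.vecMulVec v v := by
      rw [Matrix.vecMulVec_mul_vecMulVec, hvv]; simp
    simp only [sub_mul, mul_sub, one_mul, mul_one, smul_mul_assoc, mul_smul_comm, h2]
    module
  have hrow : ∀ (H : Matrix (Fin n) (Fin n) ℂ) (x : Fin n),
      (W * H) a x = (7/25) * H a x - (24/25) * H b x := by
    intro H x
    rw [hW, sub_mul, one_mul, smul_mul_assoc, Matrix.vecMulVec_mul]
    simp [Matrix.vecMulVec_apply, hv, hab, hab.symm, Matrix.add_vecMul]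
    ring
  have h0 := mom_inv μ ⟨W, hU⟩ p q r s a a a a
  simp only [hrow] at h0
  have hInt := mom_integrable μ p q r s
  have hexp : mom μ p q r s a a a a =
      ∑ x : Fin 2, ∑ y : Fin 2, ∑ z : Fin 2, ∑ w : Fin 2,
        (![7/25, -24/25] x * ![7/25, -24/25] y * ![7/25, -24/25] z * ![7/25, -24/25] w : ℂ) *
          mom μ p q r s (![a, b] x) (![a, b] y) (![a, b] z) (![a, b] w) := by
    rw [h0]
    simp only [mom, ← integral_const_mul]
    simp (maxDischargeDepth := 12) only [← integral_finsetSum, Integrable.const_mul, hInt,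
      integrable_finsetSum, implies_true]
    congr 1
    funext H
    simp [Fin.sum_univ_two]
    ring
  have hz := fun i k l j => mom_zero μ p q r s i k l j
  have hsw := mom_perm μ (Equiv.swap a b) p q r s
  have s1 : mom μ p q r s b b b b = mom μ p q r s a a a a := by rw [hsw a a a a]; simp
  have s2 : mom μ p q r s b a b a = mom μ p q r s a b a b := by rw [hsw a b a b]; simp
  have s3 : mom μ p q r s b a a b = mom μ p q r s a b b a := by rw [hsw a b b a]; simp
  simp only [Fin.sum_univ_two, Matrix.cons_val_zero, Matrix.cons_val_one, s1, s2, s3] at hexp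
  rw [hz a a a b (by simp [hab]) (by simp [hab]), hz a a b a (by simp [hab]) (by simp [hab]),
    hz a b a a (by simp [hab.symm]) (by simp [hab.symm]),
    hz b a a a (by simp [hab.symm]) (by simp [hab.symm]),
    hz a a b b (by simp [hab]) (by simp [hab]), hz b b a a (by simp [hab.symm]) (by simp [hab.symm]),
    hz b b b a (by simp [hab.symm]) (by simp [hab.symm]),
    hz b b a b (by simp [hab.symm]) (by simp [hab.symm]),
    hz b a b b (by simp [hab]) (by simp [hab]), hz a b b b (by simp [hab]) (by simp [hab])] at hexp
  linear_combination (390625/56448) * hexp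

lemma col_orth {n : ℕ} (H : Matrix.unitaryGroup (Fin n) ℂ) (p r : Fin n) :
    ∑ i, (H : Matrix (Fin n) (Fin n) ℂ) i p * star ((H : Matrix (Fin n) (Fin n) ℂ) i r)
      = if p = r then 1 else 0 := by
  have h := congrFun (congrFun (Matrix.mem_unitaryGroup_iff'.1 H.2) r) p
  simp only [Matrix.mul_apply, Matrix.star_apply, Matrix.one_apply] at h
  simp only [mul_comm, eq_comm (a := p)]
  simpa [mul_comm] using h

lemma mom_con1 {n : ℕ} (μ : Measure (Matrix.unitaryGroup (Fin n) ℂ))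
    [IsProbabilityMeasure μ] (p q r s : Fin n) :
    ∑ i, ∑ k, mom μ p q r s i k i k = (if p = r then 1 else 0) * (if q = s then 1 else 0) := by
  have hInt := mom_integrable μ p q r s
  simp only [mom]
  simp only [← integral_finsetSum, hInt, integrable_finsetSum, implies_true]
  rw [integral_congr_ae (g := fun _ => (if p = r then 1 else 0) * (if q = s then 1 else 0))]
  · simp
  refine Filter.Eventually.of_forall fun H => ?_
  simp only [← col_orth H, Finset.sum_mul_sum]
  refine Finset.sum_congr rfl fun i _ => Finset.sum_congr rfl fun k _ => ?_
  ring

lemma mom_con2 {n : ℕ} (μ : Measure (Matrix.unitaryGroup (Fin n) ℂ))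
    [IsProbabilityMeasure μ] (p q r s : Fin n) :
    ∑ i, ∑ k, mom μ p q r s i k k i = (if p = s then 1 else 0) * (if q = r then 1 else 0) := by
  have : ∀ i k, mom μ p q r s i k k i = mom μ p q s r i k i k := by
    intro i k
    simp only [mom]
    congr 1
    funext H
    ring
  simp only [this, mom_con1]

lemma sum_two {n : ℕ} (f : Fin n → Fin n → ℂ) (C A : ℂ) (hC : ∀ i, f i i = C)
    (hA : ∀ i k, i ≠ k → f i k = A) : ∑ i, ∑ k, f i k = n * C + n * (n - 1) * A := by
  have : ∀ i k, f i k = A + if i = k then C - A else 0 := by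
    intro i k
    split_ifs with h
    · subst h; rw [hC]; ring
    · rw [hA i k h]; ring
  simp only [this, Finset.sum_add_distrib]
  simp
  ring

lemma weingarten {n : ℕ} (hn : 2 ≤ n) (μ : Measure (Matrix.unitaryGroup (Fin n) ℂ))
    [μ.IsHaarMeasure] [IsProbabilityMeasure μ] (p q r s i k l j : Fin n) (D1 D2 : ℂ)
    (hD1 : D1 = (if p = r then 1 else 0) * (if q = s then 1 else 0))
    (hD2 : D2 = (if p = s then 1 else 0) * (if q = r then 1 else 0)) :
    mom μ p q r s i k l j =
      (if i = l then 1 else 0) * (if k = j then 1 else 0) *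
        ((n * D1 - D2) / ((n - 1) * n * (n + 1))) +
      (if i = j then 1 else 0) * (if k = l then 1 else 0) *
        ((n * D2 - D1) / ((n - 1) * n * (n + 1))) := by
  obtain ⟨a, b, hab⟩ : ∃ a b : Fin n, a ≠ b := ⟨⟨0, by omega⟩, ⟨1, by omega⟩, by simp⟩
  have hA : ∀ i k, i ≠ k → mom μ p q r s i k i k = mom μ p q r s a b a b := by
    intro i k h
    obtain ⟨σ, rfl, rfl⟩ := exists_perm a b i k hab h
    exact (mom_perm μ σ p q r s a b a b).symm
  have hB : ∀ i k, i ≠ k → mom μ p q r s i k k i = mom μ p q r s a b b a := by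
    intro i k h
    obtain ⟨σ, rfl, rfl⟩ := exists_perm a b i k hab h
    exact (mom_perm μ σ p q r s a b b a).symm
  have hC : ∀ i, mom μ p q r s i i i i = mom μ p q r s a a a a := by
    intro i
    rw [mom_perm μ (Equiv.swap i a)]; simp
  have hr := mom_rot μ p q r s a b hab
  have c1 := mom_con1 μ p q r s
  have c2 := mom_con2 μ p q r s
  rw [sum_two (fun i k => mom μ p q r s i k i k) _ _ hC hA, ← hD1] at c1
  rw [sum_two (fun i k => mom μ p q r s i k k i) _ _ hC hB, ← hD2] at c2
  generalize mom μ p q r s a b a b = A at *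
  generalize mom μ p q r s a b b a = B at *
  generalize mom μ p q r s a a a a = C at *
  have n0 : (n : ℂ) ≠ 0 := by norm_cast; omega
  have n1 : (n : ℂ) - 1 ≠ 0 := by
    rw [sub_ne_zero]; norm_cast; omega
  have n2 : (n : ℂ) + 1 ≠ 0 := by norm_cast
  subst hr
  have eA : A = (n * D1 - D2) / ((n - 1) * n * (n + 1)) := by
    rw [← c1, ← c2]; field_simp; ring
  have eB : B = (n * D2 - D1) / ((n - 1) * n * (n + 1)) := by
    rw [← c1, ← c2]; field_simp; ring
  rw [← eA, ← eB]
  by_cases h1 : i = l ∧ k = j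
  · obtain ⟨rfl, rfl⟩ := h1
    by_cases h : i = k
    · subst h; simp [hC]
    · simp [hA i k h, h]
  · by_cases h2 : i = j ∧ k = l
    · obtain ⟨rfl, rfl⟩ := h2
      have h : i ≠ k := fun h => h1 ⟨h, h.symm⟩
      simp [hB i k h, h]
    · rw [mom_zero μ p q r s i k l j h1 h2]
      have e1 : (if i = l then (1:ℂ) else 0) * (if k = j then 1 else 0) = 0 := by
        split_ifs <;> simp_all
      have e2 : (if i = j then (1:ℂ) else 0) * (if k = l then 1 else 0) = 0 := by
        split_ifs <;> simp_all
      rw [e1, e2]; ring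

/-- Fourth-moment identity for the first two columns of a Haar-distributed
unitary matrix:
`E[(h_{i1} h̄_{j2} - h_{i2} h̄_{j1})(h_{k1} h̄_{ℓ2} - h_{k2} h̄_{ℓ1})]
  = -2 δ_{iℓ} δ_{jk} (1-δ_{ij})/((n-1)(n+1)) + 2 δ_{ij} δ_{kℓ} (1-δ_{ik})/((n-1)n(n+1))
    - 2·𝟙{i=j=k=ℓ}/(n(n+1))`. -/
theorem haar_unitary_fourth_moments (n : ℕ) (hn : 2 ≤ n)
    (μ : Measure (Matrix.unitaryGroup (Fin n) ℂ))
    [μ.IsHaarMeasure] [IsProbabilityMeasure μ]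
    (i j k l : Fin n) :
    (∫ H : Matrix.unitaryGroup (Fin n) ℂ,
        (((H : Matrix (Fin n) (Fin n) ℂ) i ⟨0, by omega⟩ *
            star ((H : Matrix (Fin n) (Fin n) ℂ) j ⟨1, by omega⟩) -
          (H : Matrix (Fin n) (Fin n) ℂ) i ⟨1, by omega⟩ *
            star ((H : Matrix (Fin n) (Fin n) ℂ) j ⟨0, by omega⟩)) *
         ((H : Matrix (Fin n) (Fin n) ℂ) k ⟨0, by omega⟩ *
            star ((H : Matrix (Fin n) (Fin n) ℂ) l ⟨1, by omega⟩) -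
          (H : Matrix (Fin n) (Fin n) ℂ) k ⟨1, by omega⟩ *
            star ((H : Matrix (Fin n) (Fin n) ℂ) l ⟨0, by omega⟩))) ∂μ)
      = -2 * (if i = l then (1 : ℂ) else 0) * (if j = k then (1 : ℂ) else 0) *
            (1 - if i = j then (1 : ℂ) else 0) / (((n : ℂ) - 1) * ((n : ℂ) + 1))
        + 2 * (if i = j then (1 : ℂ) else 0) * (if k = l then (1 : ℂ) else 0) *
            (1 - if i = k then (1 : ℂ) else 0) / (((n : ℂ) - 1) * (n : ℂ) * ((n : ℂ) + 1))
        - 2 * (if i = j ∧ j = k ∧ k = l then (1 : ℂ) else 0) / ((n : ℂ) * ((n : ℂ) + 1)) := by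
  have hInt := mom_integrable μ
  set z : Fin n := ⟨0, by omega⟩ with hz
  set o : Fin n := ⟨1, by omega⟩ with ho
  have hzo : z ≠ o := by simp [hz, ho]
  have n0 : (n : ℂ) ≠ 0 := by norm_cast; omega
  have n1 : (n : ℂ) - 1 ≠ 0 := by
    rw [sub_ne_zero]; norm_cast; omega
  have n2 : (n : ℂ) + 1 ≠ 0 := by norm_cast
  have w1 := weingarten hn μ z z o o i k j l _ _ rfl rfl
  have w2 := weingarten hn μ z o z o i k l j _ _ rfl rfl
  have w3 := weingarten hn μ o z o z i k l j _ _ rfl rfl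
  have w4 := weingarten hn μ o o z z i k j l _ _ rfl rfl
  have hsplit : ∀ H : Matrix.unitaryGroup (Fin n) ℂ, 
      (((H : Matrix (Fin n) (Fin n) ℂ) i z * star ((H : Matrix (Fin n) (Fin n) ℂ) j o) -
          (H : Matrix (Fin n) (Fin n) ℂ) i o * star ((H : Matrix (Fin n) (Fin n) ℂ) j z)) *
         ((H : Matrix (Fin n) (Fin n) ℂ) k z * star ((H : Matrix (Fin n) (Fin n) ℂ) l o) -
          (H : Matrix (Fin n) (Fin n) ℂ) k o * star ((H : Matrix (Fin n) (Fin n) ℂ) l z))) =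
      ((H : Matrix (Fin n) (Fin n) ℂ) i z * (H : Matrix (Fin n) (Fin n) ℂ) k z *
        star ((H : Matrix (Fin n) (Fin n) ℂ) j o) * star ((H : Matrix (Fin n) (Fin n) ℂ) l o) +
      (H : Matrix (Fin n) (Fin n) ℂ) i o * (H : Matrix (Fin n) (Fin n) ℂ) k o *
        star ((H : Matrix (Fin n) (Fin n) ℂ) j z) * star ((H : Matrix (Fin n) (Fin n) ℂ) l z)) -
      ((H : Matrix (Fin n) (Fin n) ℂ) i z * (H : Matrix (Fin n) (Fin n) ℂ) k o *
        star ((H : Matrix (Fin n) (Fin n) ℂ) l z) * star ((H : Matrix (Fin n) (Fin n) ℂ) j o) +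
      (H : Matrix (Fin n) (Fin n) ℂ) i o * (H : Matrix (Fin n) (Fin n) ℂ) k z *
        star ((H : Matrix (Fin n) (Fin n) ℂ) l o) * star ((H : Matrix (Fin n) (Fin n) ℂ) j z)) := by
    intro H; ring
  simp only [hsplit]
  refine (integral_sub ((hInt z z o o i k j l).add (hInt o o z z i k j l))
    ((hInt z o z o i k l j).add (hInt o z o z i k l j))).trans ?_
  rw [integral_add' (hInt z z o o i k j l) (hInt o o z z i k j l),
    integral_add' (hInt z o z o i k l j) (hInt o z o z i k l j)]
  unfold mom at w1 w2 w3 w4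
  rw [w1, w2, w3, w4]
  simp only [hzo, hzo.symm, if_true, if_false, eq_comm (a := k) (b := j)]
  by_cases h1 : i = l
  · subst h1
    by_cases h2 : j = k
    · subst h2
      by_cases h3 : i = j
      · subst h3; simp; field_simp; ring
      · simp [h3, Ne.symm h3]; field_simp; ring
    · by_cases h3 : i = j
      · subst h3; simp [h2, Ne.symm h2]
      · simp [h2, h3, Ne.symm h3]
  · by_cases h3 : i = j
    · subst h3
      by_cases h4 : k = l
      · subst h4; simp [h1]; field_simp; ring
      · simp [h1, h4]
    · simp [h1, h3]
end

section
/- Let n ≥ 2 and let H = (h_{ij}) be a random matrix in the unitary group U(n) distributed according to Haar probability measure, with entry-wise complex conjugate denoted by a bar. Then for all indices 1 ≤ i, j, k, ℓ ≤ n, E[(h_{i1} h̄_{j2} − h_{i2} h̄_{j1})(h̄_{k1} h_{ℓ2} − h̄_{k2} h_{ℓ1})] = 2 δ_{ik} δ_{jℓ} (1 − δ_{ij}) / ((n−1)(n+1)) − 2 δ_{ij} δ_{kℓ} (1 − δ_{ik}) / (n(n−1)(n+1)) + 2·𝟙{i = j = k = ℓ} / (n(n+1)). -/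
open MeasureTheory ProbabilityTheory Matrix

namespace HaarMoments

abbrev UG (n : ℕ) := Matrix.unitaryGroup (Fin n) ℂ

instance compactUG (n : ℕ) : CompactSpace (UG n) := by
  apply isCompact_iff_compactSpace.mp
  have hK : IsCompact (Set.pi Set.univ (fun _ : Fin n => Set.pi Set.univ
      (fun _ : Fin n => Metric.closedBall (0 : ℂ) 1))) :=
    isCompact_univ_pi fun _ => isCompact_univ_pi fun _ => isCompact_closedBall _ _
  refine IsCompact.of_isClosed_subset hK ?_ ?_
  · have : ((unitaryGroup (Fin n) ℂ : Submonoid (Matrix (Fin n) (Fin n) ℂ)) :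
        Set (Matrix (Fin n) (Fin n) ℂ)) = {A | A * star A = 1} := by
      ext A
      exact Matrix.mem_unitaryGroup_iff
    rw [this]
    exact isClosed_eq (by fun_prop) continuous_const
  · intro A hA i _ j _
    simpa using entry_norm_bound_of_unitary hA i j

/-- Coordinate function. -/
noncomputable def X {n : ℕ} (a p : Fin n) : C(UG n, ℂ) :=
  ⟨fun H => (H : Matrix (Fin n) (Fin n) ℂ) a p,
    continuous_subtype_val.matrix_elem a p⟩

@[simp] lemma X_apply {n : ℕ} (a p : Fin n) (H : UG n) :
    X a p H = (H : Matrix (Fin n) (Fin n) ℂ) a p := rfl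

lemma integ {n : ℕ} (μ : Measure (UG n)) [IsProbabilityMeasure μ] (f : C(UG n, ℂ)) :
    Integrable (fun H => f H) μ :=
  f.continuous.integrable_of_hasCompactSupport (HasCompactSupport.of_compactSpace _)

/-- Expectation functional. -/
noncomputable def E {n : ℕ} (μ : Measure (UG n)) [IsProbabilityMeasure μ] :
    C(UG n, ℂ) →ₗ[ℂ] ℂ where
  toFun f := ∫ H, f H ∂μ
  map_add' f g := by
    simpa using integral_add (integ μ f) (integ μ g)
  map_smul' c f := by
    simpa using integral_const_mul c (fun H => f H)

variable {n : ℕ} (μ : Measure (UG n)) [μ.IsHaarMeasure] [IsProbabilityMeasure μ]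

lemma E_inv (U : UG n) (f g : C(UG n, ℂ)) (h : ∀ H, f H = g (U * H)) : E μ f = E μ g := by
  change ∫ H, f H ∂μ = ∫ H, g H ∂μ
  rw [← integral_mul_left_eq_self (fun H => g H) U]
  exact integral_congr_ae (Filter.Eventually.of_forall h)

/-- Second moments. -/
noncomputable def S (p r a c : Fin n) : ℂ := E μ (X a p * star (X c r))

/-- Fourth moments. -/
noncomputable def F (p q r s a b c d : Fin n) : ℂ :=
  E μ (X a p * X b q * star (X c r) * star (X d s))

/-- Diagonal phase: multiply row `a` by `I`. -/
noncomputable def phase (a : Fin n) : UG n :=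
  ⟨diagonal (Function.update 1 a Complex.I), by
    rw [Matrix.mem_unitaryGroup_iff, star_eq_conjTranspose, diagonal_conjTranspose,
      diagonal_mul_diagonal, ← diagonal_one]
    congr 1
    funext x
    by_cases h : x = a
    · subst h; simp
    · simp [h]⟩

lemma phase_apply (a x p : Fin n) (H : UG n) :
    X x p (phase a * H) = (if x = a then Complex.I else 1) * X x p H := by
  simp [phase, Function.update_apply]

/-- Swap of rows. -/
noncomputable def perm (σ : Equiv.Perm (Fin n)) : UG n :=
  ⟨σ.permMatrix ℂ, by
    rw [Matrix.mem_unitaryGroup_iff, star_eq_conjTranspose, conjTranspose_permMatrix,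
      ← permMatrix_mul]
    simp⟩

lemma perm_apply (σ : Equiv.Perm (Fin n)) (x p : Fin n) (H : UG n) :
    X x p (perm σ * H) = X (σ x) p H := by
  simp [perm, PEquiv.toMatrix_toPEquiv_mul]

/-- Householder reflection. -/
noncomputable def refl (a b : Fin n) (hab : a ≠ b) : UG n :=
  ⟨1 - (2 : ℂ) • vecMulVec (Pi.single a (3/5 : ℂ) + Pi.single b (4/5 : ℂ))
      (Pi.single a (3/5 : ℂ) + Pi.single b (4/5 : ℂ)), by
    set v : Fin n → ℂ := Pi.single a (3/5 : ℂ) + Pi.single b (4/5 : ℂ) with hv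
    have h1 : v ⬝ᵥ v = 1 := by
      simp [hv, hab, hab.symm]; norm_num
    have h2 : star v = v := by
      funext x
      simp only [hv, Pi.star_apply, Pi.add_apply, Pi.single_apply]
      split_ifs <;> simp
    have h3 : vecMulVec v v * vecMulVec v v = vecMulVec v v := by
      rw [vecMulVec_mul_vecMulVec, h1, one_smul]
    have h4 : star (vecMulVec v v) = vecMulVec v v := by
      rw [star_eq_conjTranspose, conjTranspose_vecMulVec, h2]
    rw [Matrix.mem_unitaryGroup_iff, star_sub, star_smul, h4, star_one]
    have h5 : star (2 : ℂ) = 2 := by simp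
    rw [h5, sub_mul, mul_sub, mul_sub, smul_mul_smul_comm, h3]
    simp only [one_mul, mul_one]
    module⟩

lemma refl_apply (a b p : Fin n) (hab : a ≠ b) (H : UG n) :
    X a p (refl a b hab * H) = (7/25) * X a p H - (24/25) * X b p H := by
  have : (((refl a b hab * H : UG n)) : Matrix (Fin n) (Fin n) ℂ) =
    ((1 : Matrix (Fin n) (Fin n) ℂ) -
      (2 : ℂ) • vecMulVec (Pi.single a (3/5 : ℂ) + Pi.single b (4/5 : ℂ))
      (Pi.single a (3/5 : ℂ) + Pi.single b (4/5 : ℂ))) * (H : Matrix (Fin n) (Fin n) ℂ) := rfl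
  rw [X_apply, this, sub_mul, smul_mul_assoc, vecMulVec_mul]
  simp [vecMulVec_apply, hab, add_vecMul]
  ring

lemma S_phase (p r a c : Fin n) (h : a ≠ c) : S μ p r a c = 0 := by
  have : S μ p r a c = Complex.I * S μ p r a c := by
    unfold S
    rw [← smul_eq_mul Complex.I, ← map_smul]
    symm
    apply E_inv μ (phase a)
    intro H
    simp only [ContinuousMap.smul_apply, ContinuousMap.mul_apply, ContinuousMap.star_apply,
      phase_apply, h.symm, if_true, if_false, smul_eq_mul]
    ring
  have h2 : (1 - Complex.I) * S μ p r a c = 0 := by linear_combination this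
  rcases mul_eq_zero.mp h2 with h3 | h3
  · simp [Complex.ext_iff] at h3
  · exact h3

lemma F_phase (x p q r s a b c d : Fin n) :
    F μ p q r s a b c d = ((if a = x then Complex.I else 1) * (if b = x then Complex.I else 1) *
      star (if c = x then Complex.I else 1) * star (if d = x then Complex.I else 1)) *
      F μ p q r s a b c d := by
  unfold F
  rw [← smul_eq_mul _ (E μ _), ← map_smul]
  symm
  apply E_inv μ (phase x)
  intro H
  simp only [ContinuousMap.smul_apply, ContinuousMap.mul_apply, ContinuousMap.star_apply,
    phase_apply, smul_eq_mul, star_mul']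
  ring

lemma F_zero (p q r s a b c d : Fin n) (h1 : ¬ (a = c ∧ b = d)) (h2 : ¬ (a = d ∧ b = c)) :
    F μ p q r s a b c d = 0 := by
  have key : ∀ z : ℂ, z ≠ 1 → F μ p q r s a b c d = z * F μ p q r s a b c d →
      F μ p q r s a b c d = 0 := by
    intro z hz h
    have h2 : (1 - z) * F μ p q r s a b c d = 0 := by linear_combination h
    rcases mul_eq_zero.mp h2 with h3 | h3
    · exact absurd (sub_eq_zero.mp h3).symm hz
    · exact h3
  have ha := fun h => key _ h (F_phase μ a p q r s a b c d)
  have hb := fun h => key _ h (F_phase μ b p q r s a b c d)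
  by_cases hca : c = a <;> by_cases hda : d = a <;> by_cases hba : b = a <;>
    by_cases hcb : c = b <;> by_cases hdb : d = b <;>
    first
    | (exfalso; grind)
    | (apply ha; simp [hca, hda, hba, Complex.ext_iff]; done)
    | (apply ha; simp [hca, hda, hba, Complex.ext_iff]; norm_num; done)
    | (apply hb; simp [hcb, hdb, Ne.symm hba, Complex.ext_iff]; done)

lemma S_perm (σ : Equiv.Perm (Fin n)) (p r a c : Fin n) :
    S μ p r (σ a) (σ c) = S μ p r a c := by
  apply E_inv μ (perm σ)
  intro H
  simp only [ContinuousMap.mul_apply, ContinuousMap.star_apply, perm_apply]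

lemma F_perm (σ : Equiv.Perm (Fin n)) (p q r s a b c d : Fin n) :
    F μ p q r s (σ a) (σ b) (σ c) (σ d) = F μ p q r s a b c d := by
  apply E_inv μ (perm σ)
  intro H
  simp only [ContinuousMap.mul_apply, ContinuousMap.star_apply, perm_apply]

lemma X_orth (p r : Fin n) :
    ∑ a, X a p * star (X a r) = (if p = r then 1 else 0 : ℂ) • (1 : C(UG n, ℂ)) := by
  ext H
  have h := congrFun (congrFun (Matrix.mem_unitaryGroup_iff'.mp H.2) r) p
  rw [star_eq_conjTranspose, mul_apply, one_apply] at h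
  simp only [conjTranspose_apply] at h
  simp only [ContinuousMap.sum_apply, ContinuousMap.mul_apply, ContinuousMap.star_apply,
    X_apply, ContinuousMap.smul_apply, ContinuousMap.one_apply, smul_eq_mul, mul_one]

  simp only [eq_comm (a := p)]
  rw [← h]
  exact Finset.sum_congr rfl fun _ _ => mul_comm _ _

lemma E_one : E μ 1 = 1 := by
  change ∫ H, (1 : ℂ) ∂μ = 1
  simp

lemma S_diag (p r a : Fin n) : (n : ℂ) * S μ p r a a = if p = r then 1 else 0 := by
  have h := congrArg (E μ) (X_orth p r)
  rw [map_sum, map_smul, E_one] at h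
  have h2 : ∀ x, E μ (X x p * star (X x r)) = S μ p r a a := by
    intro x
    have := S_perm μ (Equiv.swap a x) p r a a
    simpa [S] using this
  simp only [h2] at h
  simpa using h

lemma sum1 (p q r s a : Fin n) :
    ∑ b, F μ p q r s a b a b = (if q = s then 1 else 0) * S μ p r a a := by
  unfold F S
  rw [← map_sum, ← smul_eq_mul, ← map_smul]
  congr 1
  calc _ = (X a p * star (X a r)) * ∑ b, X b q * star (X b s) := by
        rw [Finset.mul_sum]; exact Finset.sum_congr rfl fun _ _ => by ring
    _ = _ := by rw [X_orth, mul_smul_comm, mul_one]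

lemma sum2 (p q r s a : Fin n) :
    ∑ b, F μ p q r s a b b a = (if q = r then 1 else 0) * S μ p s a a := by
  unfold F S
  rw [← map_sum, ← smul_eq_mul, ← map_smul]
  congr 1
  calc _ = (X a p * star (X a s)) * ∑ b, X b q * star (X b r) := by
        rw [Finset.mul_sum]; exact Finset.sum_congr rfl fun _ _ => by ring
    _ = _ := by rw [X_orth, mul_smul_comm, mul_one]

lemma sum_const (f : Fin n → ℂ) (a b : Fin n) (h : ∀ x, x ≠ a → f x = f b) :
    ∑ x, f x = f a + ((n : ℂ) - 1) * f b := by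
  have hn : 1 ≤ n := by have := a.2; omega
  rw [← Finset.add_sum_erase _ _ (Finset.mem_univ a),
    Finset.sum_congr rfl (fun x hx => h x (Finset.ne_of_mem_erase hx))]
  simp [Nat.cast_sub hn]

lemma rel1 (p q r s a b : Fin n) (hab : a ≠ b) :
    F μ p q r s a a a a + ((n : ℂ) - 1) * F μ p q r s a b a b
      = (if q = s then 1 else 0) * S μ p r a a := by
  rw [← sum1]
  refine (sum_const (fun x => F μ p q r s a x a x) a b ?_).symm
  intro x hx
  have := F_perm μ (Equiv.swap b x) p q r s a b a b
  rwa [Equiv.swap_apply_of_ne_of_ne hab hx.symm, Equiv.swap_apply_left] at this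

lemma rel2 (p q r s a b : Fin n) (hab : a ≠ b) :
    F μ p q r s a a a a + ((n : ℂ) - 1) * F μ p q r s a b b a
      = (if q = r then 1 else 0) * S μ p s a a := by
  rw [← sum2]
  refine (sum_const (fun x => F μ p q r s a x x a) a b ?_).symm
  intro x hx
  have := F_perm μ (Equiv.swap b x) p q r s a b b a
  rwa [Equiv.swap_apply_of_ne_of_ne hab hx.symm, Equiv.swap_apply_left] at this

lemma rel3 (p q r s a b : Fin n) (hab : a ≠ b) :
    F μ p q r s a a a a = F μ p q r s a b a b + F μ p q r s a b b a := by
  have hba := hab.symm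
  have h : E μ (((7/25 : ℂ) • X a p - (24/25 : ℂ) • X b p) *
      ((7/25 : ℂ) • X a q - (24/25 : ℂ) • X b q) *
      ((7/25 : ℂ) • star (X a r) - (24/25 : ℂ) • star (X b r)) *
      ((7/25 : ℂ) • star (X a s) - (24/25 : ℂ) • star (X b s))) = F μ p q r s a a a a := by
    apply E_inv μ (refl a b hab)
    intro H
    simp only [ContinuousMap.mul_apply, ContinuousMap.star_apply, refl_apply,
      ContinuousMap.sub_apply, ContinuousMap.smul_apply, smul_eq_mul]
    simp
  simp only [mul_sub, sub_mul, smul_mul_smul_comm, map_sub, map_smul] at h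
  have e : ∀ a b c d, E μ (X a p * X b q * star (X c r) * star (X d s)) = F μ p q r s a b c d :=
    fun _ _ _ _ => rfl
  simp only [e] at h
  have z := fun a b c d => F_zero μ p q r s a b c d
  rw [z a a a b (by grind) (by grind), z a a b a (by grind) (by grind),
    z a b a a (by grind) (by grind), z b a a a (by grind) (by grind),
    z a a b b (by grind) (by grind), z b b a a (by grind) (by grind),
    z b b b a (by grind) (by grind), z b b a b (by grind) (by grind),
    z b a b b (by grind) (by grind), z a b b b (by grind) (by grind)] at h
  have s1 := F_perm μ (Equiv.swap a b) p q r s a a a a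
  have s2 := F_perm μ (Equiv.swap a b) p q r s a b a b
  have s3 := F_perm μ (Equiv.swap a b) p q r s a b b a
  simp only [Equiv.swap_apply_left, Equiv.swap_apply_right] at s1 s2 s3
  rw [s1, s2, s3] at h
  simp only [smul_eq_mul] at h
  linear_combination (-(25^4 / (2 * 7^2 * 24^2)) : ℂ) * h

lemma weingarten (hn : 2 ≤ n) (p q r s a b c d : Fin n) :
    F μ p q r s a b c d =
      (((if a = c ∧ b = d then 1 else 0) * (if p = r ∧ q = s then 1 else 0) +
        (if a = d ∧ b = c then 1 else 0) * (if p = s ∧ q = r then 1 else 0)) * n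
      - ((if a = c ∧ b = d then 1 else 0) * (if p = s ∧ q = r then 1 else 0) +
        (if a = d ∧ b = c then 1 else 0) * (if p = r ∧ q = s then 1 else 0)))
      / ((n : ℂ) * ((n : ℂ) - 1) * ((n : ℂ) + 1)) := by
  have n0 : (n : ℂ) ≠ 0 := by exact_mod_cast (by omega : n ≠ 0)
  have n1 : (n : ℂ) - 1 ≠ 0 := sub_ne_zero.mpr (by exact_mod_cast (by omega : n ≠ 1))
  have n2 : (n : ℂ) + 1 ≠ 0 := by exact_mod_cast (by omega : n + 1 ≠ 0)
  rw [eq_div_iff (by positivity)]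
  set P : ℂ := if p = r ∧ q = s then 1 else 0 with hP
  set Q : ℂ := if p = s ∧ q = r then 1 else 0 with hQ
  have main : ∀ a b : Fin n, a ≠ b →
      (F μ p q r s a a a a * (n * (n + 1)) = P + Q) ∧
      (F μ p q r s a b a b * (n * (n - 1) * (n + 1)) = P * n - Q) ∧
      (F μ p q r s a b b a * (n * (n - 1) * (n + 1)) = Q * n - P) := by
    intro a b hab
    have r1 := rel1 μ p q r s a b hab
    have r2 := rel2 μ p q r s a b hab
    have r3 := rel3 μ p q r s a b hab
    have d1 := S_diag μ p r a
    have d2 := S_diag μ p s a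
    have p1 : P = (if q = s then 1 else 0) * (n * S μ p r a a) := by
      rw [d1, hP]; split_ifs <;> simp_all
    have p2 : Q = (if q = r then 1 else 0) * (n * S μ p s a a) := by
      rw [d2, hQ]; split_ifs <;> simp_all
    have rone : n * (F μ p q r s a a a a + ((n : ℂ) - 1) * F μ p q r s a b a b) = P := by
      rw [r1, p1]; ring
    have rtwo : n * (F μ p q r s a a a a + ((n : ℂ) - 1) * F μ p q r s a b b a) = Q := by
      rw [r2, p2]; ring
    have hC : F μ p q r s a a a a * (n * (n + 1)) = P + Q := by
      linear_combination rone + rtwo + n * (n - 1) * r3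
    refine ⟨hC, ?_, ?_⟩
    · linear_combination (n + 1) * rone - hC
    · linear_combination (n + 1) * rtwo - hC
  by_cases h1 : a = c ∧ b = d
  · obtain ⟨rfl, rfl⟩ := h1
    by_cases hab : a = b
    · subst hab
      have : Nontrivial (Fin n) := Fin.nontrivial_iff_two_le.mpr hn
      obtain ⟨b, hb⟩ := exists_ne a
      have := (main a b hb.symm).1
      simp only [and_self, if_true]
      linear_combination (n - 1) * this
    · have := (main a b hab).2.1
      simp [hab]
      linear_combination this
  · by_cases h2 : a = d ∧ b = c
    · obtain ⟨rfl, rfl⟩ := h2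
      have hab : a ≠ b := by grind
      have := (main a b hab).2.2
      simp [hab]
      linear_combination this
    · rw [F_zero μ p q r s a b c d h1 h2]
      simp [h1, h2]

end HaarMoments

/-- Mixed fourth-moment identity for the first two columns of a
Haar-distributed unitary matrix:
`E[(h_{i1} h̄_{j2} - h_{i2} h̄_{j1})(h̄_{k1} h_{ℓ2} - h̄_{k2} h_{ℓ1})]
  = 2 δ_{ik} δ_{jℓ} (1-δ_{ij})/((n-1)(n+1)) - 2 δ_{ij} δ_{kℓ} (1-δ_{ik})/(n(n-1)(n+1))
    + 2·𝟙{i=j=k=ℓ}/(n(n+1))`. -/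
theorem haar_unitary_mixed_fourth_moments (n : ℕ) (hn : 2 ≤ n)
    (μ : Measure (Matrix.unitaryGroup (Fin n) ℂ))
    [μ.IsHaarMeasure] [IsProbabilityMeasure μ]
    (i j k l : Fin n) :
    (∫ H : Matrix.unitaryGroup (Fin n) ℂ,
        (((H : Matrix (Fin n) (Fin n) ℂ) i ⟨0, by omega⟩ *
            star ((H : Matrix (Fin n) (Fin n) ℂ) j ⟨1, by omega⟩) -
          (H : Matrix (Fin n) (Fin n) ℂ) i ⟨1, by omega⟩ *
            star ((H : Matrix (Fin n) (Fin n) ℂ) j ⟨0, by omega⟩)) *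
         (star ((H : Matrix (Fin n) (Fin n) ℂ) k ⟨0, by omega⟩) *
            (H : Matrix (Fin n) (Fin n) ℂ) l ⟨1, by omega⟩ -
          star ((H : Matrix (Fin n) (Fin n) ℂ) k ⟨1, by omega⟩) *
            (H : Matrix (Fin n) (Fin n) ℂ) l ⟨0, by omega⟩)) ∂μ)
      = 2 * (if i = k then (1 : ℂ) else 0) * (if j = l then (1 : ℂ) else 0) *
            (1 - if i = j then (1 : ℂ) else 0) / (((n : ℂ) - 1) * ((n : ℂ) + 1))
        - 2 * (if i = j then (1 : ℂ) else 0) * (if k = l then (1 : ℂ) else 0) *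
            (1 - if i = k then (1 : ℂ) else 0) / ((n : ℂ) * ((n : ℂ) - 1) * ((n : ℂ) + 1))
        + 2 * (if i = j ∧ j = k ∧ k = l then (1 : ℂ) else 0) / ((n : ℂ) * ((n : ℂ) + 1)) := by
  
  have h0 : (0 : ℕ) < n := by omega
  have h1 : (1 : ℕ) < n := by omega
  have n0 : (n : ℂ) ≠ 0 := by exact_mod_cast (by omega : n ≠ 0)
  have n1 : (n : ℂ) - 1 ≠ 0 := sub_ne_zero.mpr (by exact_mod_cast (by omega : n ≠ 1))
  have n2 : (n : ℂ) + 1 ≠ 0 := by exact_mod_cast (by omega : n + 1 ≠ 0)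
  let p : Fin n := ⟨0, h0⟩
  let q : Fin n := ⟨1, h1⟩
  have hpq : p ≠ q := by simp [p, q, Fin.ext_iff]
  have key : HaarMoments.E μ
      ((HaarMoments.X i p * star (HaarMoments.X j q) -
        HaarMoments.X i q * star (HaarMoments.X j p)) *
       (star (HaarMoments.X k p) * HaarMoments.X l q -
        star (HaarMoments.X k q) * HaarMoments.X l p)) =
      HaarMoments.F μ p q p q i l k j - HaarMoments.F μ p p q q i l k j
      - HaarMoments.F μ q q p p i l k j + HaarMoments.F μ q p q p i l k j := by
    unfold HaarMoments.F
    rw [← map_sub, ← map_sub, ← map_add]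
    congr 1
    ring
  refine Eq.trans (show _ = _ from rfl) (key.trans ?_)
  simp only [HaarMoments.weingarten μ hn]
  simp only [hpq, hpq.symm, and_self, if_true, if_false, false_and]
  by_cases hij : i = j
  · subst hij
    by_cases hkl : k = l
    · subst hkl
      by_cases hik : i = k
      · subst hik
        simp
        field_simp
        ring
      · simp [hik, Ne.symm hik]
        field_simp
        ring
    · have e1 : ¬ (i = k ∧ l = i) := by grind
      have e2 : ¬ (i = k ∧ i = l) := by grind
      simp [hkl, Ne.symm hkl, e1]
  · by_cases hik : i = k
    · subst hik
      by_cases hjl : j = l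
      · subst hjl
        simp [hij]
        field_simp
        ring
      · simp [hij, hjl, Ne.symm hjl]
    · simp [hij, hik]
end
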